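/- arXiv:2009.08733 — 2 statements merged into one kernel-verified Lean document; each statement's English description precedes it below -/
import Mathlib

section
/- The holonomy group of the weighted connection ∇^φ of the round sphere with density (Sⁿ, dr² + sin²r · g_{Sⁿ⁻¹}, φ = cos r) is precisely SLₙ(ℝ), for every n ≥ 2. -/
open scoped RealInnerProductSpace

/-!
STATEMENT 16.  The holonomy group of the weighted connection `∇^φ` of the round sphere
with density `(Sⁿ, dr² + sin²r·g_{Sⁿ⁻¹}, φ = cos r)` is precisely `SLₙ(ℝ)`, for every
`n ≥ 2`.

The sphere is realized as the unit sphere of `ℝ^{n+1}`; with `e₀` the pole about which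
the polar coordinate `r` is taken, the density function is `φ(x) = cos r(x) = ⟨x, e₀⟩`,
and its differential on tangent vectors is `dφ_x(v) = ⟨v, e₀⟩`.  For a tangent field
`X` along a curve `σ` on the sphere, the Levi-Civita covariant derivative is
`D_tX = X' + ⟨X, σ'⟩σ`, so the weighted parallel transport equation
`∇^φ_{σ'}X = D_tX − dφ(σ')X − dφ(X)σ' = 0` reads
`X' = ⟨σ', e₀⟩X + ⟨X, e₀⟩σ' − ⟨X, σ'⟩σ`.  The tangent space at `p` is
`T_pSⁿ = (ℝp)ᗮ`, and `SLₙ(ℝ)` is its group of determinant-one linear maps.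
-/

/-- `A : T_pSⁿ → T_pSⁿ` is the `∇^φ`-parallel translation around some piecewise `C¹`
loop on the sphere based at `p`, for the density `φ = cos r = ⟨·, e₀⟩`. -/
def IsSphereWeightedLoopTransport (n : ℕ) (e₀ p : EuclideanSpace ℝ (Fin (n + 1)))
    (A : ↥((Submodule.span ℝ {p})ᗮ) →ₗ[ℝ] ↥((Submodule.span ℝ {p})ᗮ)) : Prop :=
  ∃ (T : ℝ) (σ σd : ℝ → EuclideanSpace ℝ (Fin (n + 1))) (exc : Finset ℝ),
    0 < T ∧ Continuous σ ∧ (∀ t, ‖σ t‖ = 1) ∧ σ 0 = p ∧ σ T = p ∧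
    (∀ t ∉ exc, HasDerivAt σ (σd t) t) ∧
    (∃ C, ∀ t ∈ Set.Icc (0 : ℝ) T, ‖σd t‖ ≤ C) ∧
    ∀ v : ↥((Submodule.span ℝ {p})ᗮ),
      ∃ X : ℝ → EuclideanSpace ℝ (Fin (n + 1)),
        Continuous X ∧ X 0 = (v : EuclideanSpace ℝ (Fin (n + 1))) ∧
        (∀ t, ⟪X t, σ t⟫ = 0) ∧
        (∀ t ∉ exc, HasDerivAt X
          (⟪σd t, e₀⟫ • X t + ⟪X t, e₀⟫ • σd t - ⟪X t, σd t⟫ • σ t) t) ∧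
        X T = (A v : EuclideanSpace ℝ (Fin (n + 1)))


section MatrixAlgebra

set_option linter.unusedSectionVars false

variable {ι : Type*} [Fintype ι] [DecidableEq ι]

/-- The two by two matrix `[a b; c d]` placed in the `(i,j)` block of the identity matrix. -/
noncomputable def emb2 (i j : ι) (a b c d : ℝ) : Matrix ι ι ℝ :=
  1 + Matrix.single i i (a - 1) + Matrix.single i j b + Matrix.single j i c
    + Matrix.single j j (d - 1)

lemma emb2_mul {i j : ι} (hij : i ≠ j) (a b c d a' b' c' d' : ℝ) :
    emb2 i j a b c d * emb2 i j a' b' c' d'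
      = emb2 i j (a * a' + b * c') (a * b' + b * d') (c * a' + d * c') (c * b' + d * d') := by
  have hji := hij.symm
  unfold emb2
  simp only [mul_add, add_mul, Matrix.single_mul_single_same, one_mul, mul_one,
    Matrix.single_mul_single_of_ne _ _ _ _ hij, Matrix.single_mul_single_of_ne _ _ _ _ hji, add_zero]
  ext k l
  simp only [Matrix.add_apply, Matrix.single_apply]
  split_ifs <;> simp_all <;> ring

lemma emb2_one (i j : ι) : emb2 i j 1 0 0 1 = 1 := by simp [emb2]

lemma emb2_swap (i j : ι) (a b c d : ℝ) : emb2 i j a b c d = emb2 j i d c b a := by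
  unfold emb2; abel

lemma transvection_eq_emb2 (i j : ι) (c : ℝ) :
    Matrix.transvection i j c = emb2 i j 1 c 0 1 := by
  simp [emb2, Matrix.transvection]

lemma emb2_diag {i j : ι} (hij : i ≠ j) (a d : ℝ) :
    emb2 i j a 0 0 d = Matrix.diagonal (Pi.mulSingle i a * Pi.mulSingle j d) := by
  ext k l
  have hji := hij.symm
  simp only [emb2, Matrix.add_apply, Matrix.single_apply, Matrix.diagonal_apply, Matrix.one_apply,
    Pi.mul_apply, Pi.mulSingle_apply]
  by_cases hk : k = i <;> by_cases hk' : k = j <;> by_cases hl : l = i <;> by_cases hl' : l = j <;>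
    by_cases hkl : k = l <;> grind

lemma det_one_mem_of_transvections (P : Submonoid (Matrix ι ι ℝ))
    (hP : ∀ i j : ι, i ≠ j → ∀ c : ℝ, emb2 i j 1 c 0 1 ∈ P) (M : Matrix ι ι ℝ)
    (hM : M.det = 1) : M ∈ P := by
  have hd : ∀ i j : ι, i ≠ j → ∀ a : ℝ, a ≠ 0 → emb2 i j a 0 0 a⁻¹ ∈ P := by
    intro i j hij a ha
    have hU := hP i j hij
    have hL : ∀ c, emb2 i j 1 0 c 1 ∈ P := fun c => by
      rw [emb2_swap]; exact hP j i hij.symm c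
    have := mul_mem (mul_mem (mul_mem (hU a) (hL (-a⁻¹))) (hU a))
      (mul_mem (mul_mem (hU (-1)) (hL 1)) (hU (-1)))
    simp only [emb2_mul hij] at this
    convert this using 2 <;> field_simp <;> ring
  obtain ⟨L, L', D, h⟩ := Matrix.Pivot.exists_list_transvec_mul_diagonal_mul_list_transvec M
  have hL : ∀ L : List (Matrix.TransvectionStruct ι ℝ),
      (L.map Matrix.TransvectionStruct.toMatrix).prod ∈ P := by
    intro L
    refine Submonoid.list_prod_mem _ ?_
    intro x hx
    obtain ⟨t, -, rfl⟩ := List.mem_map.1 hx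
    obtain ⟨i, j, hij, c⟩ := t
    rw [Matrix.TransvectionStruct.toMatrix_mk, transvection_eq_emb2]
    exact hP i j hij c
  rw [h]
  refine mul_mem (mul_mem (hL _) ?_) (hL _)
  have hD : ∏ i, D i = 1 := by
    rw [h] at hM
    simpa [Matrix.TransvectionStruct.det_toMatrix_prod] using hM
  cases isEmpty_or_nonempty ι with
  | inl hE =>
    have : Matrix.diagonal D = (1 : Matrix ι ι ℝ) := Subsingleton.elim _ _
    rw [this]; exact one_mem _
  | inr hN =>
    obtain ⟨i₀⟩ := hN
    have hD0 : ∀ i, D i ≠ 0 := by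
      intro i hi
      rw [Finset.prod_eq_zero (Finset.mem_univ i) hi] at hD
      exact zero_ne_one hD
    let Q : Submonoid (ι → ℝ) :=
      { carrier := {d | Matrix.diagonal d ∈ P}
        one_mem' := by
          have : Matrix.diagonal (1 : ι → ℝ) = (1 : Matrix ι ι ℝ) := by ext; simp [Matrix.diagonal_apply, Matrix.one_apply]
          simp [this, one_mem]
        mul_mem' := by
          intro a b ha hb
          have := P.mul_mem ha hb
          rw [Matrix.diagonal_mul_diagonal] at this
          exact this }
    have key : D = ∏ j, (Pi.mulSingle j (D j) * Pi.mulSingle i₀ (D j)⁻¹) := by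
      rw [Finset.prod_mul_distrib, Finset.univ_prod_mulSingle]
      have : (∏ j, Pi.mulSingle i₀ (D j)⁻¹ : ι → ℝ) = 1 := by
        have := map_prod (MonoidHom.mulSingle (fun _ : ι => ℝ) i₀) (fun j => (D j)⁻¹) Finset.univ
        simp only [MonoidHom.mulSingle_apply] at this
        rw [← this, Finset.prod_inv_distrib, hD]; simp
      rw [this, mul_one]
    have : D ∈ Q := by
      rw [key]
      refine Submonoid.prod_mem _ ?_
      intro j _
      show Matrix.diagonal _ ∈ P
      by_cases hj : j = i₀
      · subst hj
        have : (Pi.mulSingle j (D j) * Pi.mulSingle j (D j)⁻¹ : ι → ℝ) = 1 := by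
          rw [← Pi.mulSingle_mul, mul_inv_cancel₀ (hD0 j)]; simp
        rw [this]
        exact Q.one_mem
      · rw [← emb2_diag hj]
        exact hd _ _ hj _ (hD0 j)
    exact this

/-- A submonoid normalized by plane rotations and containing suitable twisted shears contains
all determinant-one matrices. -/
lemma det_one_mem_of_twisted (G : Submonoid (Matrix ι ι ℝ)) (κ : ℝ) (hκ : κ ≠ 0)
    (h1 : ∀ i j : ι, i ≠ j → ∀ t : ℝ, emb2 i j (Real.cos t + Real.sin t * (κ * t)) (-Real.sin t)
      (Real.sin t - Real.cos t * (κ * t)) (Real.cos t) ∈ G)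
    (h2 : ∀ i j : ι, i ≠ j → ∀ t : ℝ, ∀ M ∈ G,
      emb2 i j (Real.cos t) (-Real.sin t) (Real.sin t) (Real.cos t) * M
       * emb2 i j (Real.cos t) (Real.sin t) (-Real.sin t) (Real.cos t) ∈ G)
    (M : Matrix ι ι ℝ) (hM : M.det = 1) : M ∈ G := by
  have h3 : ∀ i j : ι, i ≠ j → ∀ x : ℝ, ∀ M ∈ G,
      emb2 i j 1 0 x 1 * M * emb2 i j 1 0 (-x) 1 ∈ G := by
    intro i j hij x M hM
    obtain ⟨t, rfl⟩ : ∃ t, x = -(κ * t) := ⟨-x / κ, by field_simp⟩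
    have a1 := h1 i j hij t
    have a2 := h2 i j hij t _ (h1 i j hij (-t))
    have a3 := h2 i j hij (-t) _ (mul_mem (mul_mem a1 hM) a2)
    simp only [Real.cos_neg, Real.sin_neg, neg_neg] at a3
    have cs := Real.sin_sq_add_cos_sq t
    have e1 : emb2 i j 1 0 (-(κ * t)) 1 = emb2 i j (Real.cos t) (Real.sin t) (-Real.sin t) (Real.cos t)
      * emb2 i j (Real.cos t + Real.sin t * (κ * t)) (-Real.sin t)
      (Real.sin t - Real.cos t * (κ * t)) (Real.cos t) := by
      rw [emb2_mul hij]
      congr 1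
      · linear_combination (-1 : ℝ) * cs
      · ring
      · linear_combination (κ * t) * cs
      · linear_combination (-1 : ℝ) * cs
    have e2 : emb2 i j (Real.cos t) (Real.sin t) (-Real.sin t) (Real.cos t)
        * emb2 i j (Real.cos t) (-Real.sin t) (Real.sin t) (Real.cos t) = 1 := by
      rw [emb2_mul hij, ← emb2_one i j]
      congr 1
      · linear_combination cs
      · ring
      · ring
      · linear_combination cs
    have e3 : emb2 i j 1 0 (-(-(κ * t))) 1
        = emb2 i j (Real.cos t) (-Real.sin t) (Real.sin t) (Real.cos t) *
            emb2 i j (Real.cos t + -Real.sin t * (κ * -t)) (Real.sin t)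
              (-Real.sin t - Real.cos t * (κ * -t)) (Real.cos t) := by
      rw [emb2_mul hij]
      congr 1
      · linear_combination (-1 : ℝ) * cs
      · ring
      · linear_combination (-κ * t) * cs
      · linear_combination (-1 : ℝ) * cs
    rw [e1, e3]
    simp only [mul_assoc] at a3 ⊢
    rw [e2] at a3
    simpa only [mul_one] using a3
  let N : Submonoid (Matrix ι ι ℝ) :=
    { carrier := {g | ∃ g', g * g' = 1 ∧ ∀ M ∈ G, g * M * g' ∈ G}
      one_mem' := ⟨1, by simp, by simp⟩
      mul_mem' := by
        rintro a b ⟨a', ha, ha'⟩ ⟨b', hb, hb'⟩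
        refine ⟨b' * a', ?_, ?_⟩
        · rw [mul_assoc, ← mul_assoc b, hb, one_mul, ha]
        · intro M hM
          have := ha' _ (hb' M hM)
          simpa only [mul_assoc] using this }
  have hN : ∀ M : Matrix ι ι ℝ, M.det = 1 → M ∈ N := by
    apply det_one_mem_of_transvections
    intro i j hij c
    rw [emb2_swap]
    refine ⟨emb2 j i 1 0 (-c) 1, ?_, h3 j i hij.symm c⟩
    rw [emb2_mul hij.symm, ← emb2_one j i]
    congr 1 <;> ring
  have hscale : ∀ i j : ι, i ≠ j → ∀ c l : ℝ, l ≠ 0 → emb2 i j 1 0 c 1 ∈ G →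
      emb2 i j 1 0 (c / l ^ 2) 1 ∈ G := by
    intro i j hij c l hl hc
    have hdet : (emb2 i j l 0 0 l⁻¹).det = 1 := by
      rw [emb2_diag hij, Matrix.det_diagonal]
      simp only [Pi.mul_apply]
      rw [Finset.prod_mul_distrib]
      simp [Finset.prod_pi_mulSingle, hl]
    obtain ⟨g', hg, hg'⟩ := hN _ hdet
    have : g' = emb2 i j l⁻¹ 0 0 l := by
      have h : emb2 i j l⁻¹ 0 0 l * emb2 i j l 0 0 l⁻¹ = 1 := by
        rw [emb2_mul hij, ← emb2_one i j]
        congr 1 <;> field_simp <;> ring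
      calc g' = (emb2 i j l⁻¹ 0 0 l * emb2 i j l 0 0 l⁻¹) * g' := by rw [h, one_mul]
        _ = _ := by rw [mul_assoc, hg, mul_one]
    have h := hg' _ hc
    rw [this, emb2_mul hij, emb2_mul hij] at h
    convert h using 2 <;> field_simp <;> ring
  refine det_one_mem_of_transvections G ?_ M hM
  intro i j hij x
  rw [emb2_swap]
  have hπ := Real.pi_pos
  have p1 := h1 j i hij.symm (2 * Real.pi)
  have p2 := h1 j i hij.symm (-(2 * Real.pi))
  simp only [Real.cos_two_pi, Real.sin_two_pi, Real.cos_neg, Real.sin_neg, neg_zero, zero_mul,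
    add_zero, zero_sub, one_mul] at p1 p2
  set c := -(κ * (2 * Real.pi)) with hc
  have hc' : -(κ * -(2 * Real.pi)) = -c := by rw [hc]; ring
  rw [hc'] at p2
  have hc0 : c ≠ 0 := by
    rw [hc]; exact neg_ne_zero.2 (mul_ne_zero hκ (by positivity))
  rcases lt_trichotomy (c * x) 0 with h | h | h
  · have hx : x ≠ 0 := by rintro rfl; simp at h
    have hq : 0 < -c / x := by
      have : -c / x = -(c * x) / x ^ 2 := by field_simp
      rw [this]; exact div_pos (by linarith) (by positivity)
    have := hscale j i hij.symm (-c) (Real.sqrt (-c / x)) (Real.sqrt_ne_zero'.2 hq) p2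
    rw [Real.sq_sqrt hq.le] at this
    convert this using 2
    field_simp
  · have hx : x = 0 := by
      rcases mul_eq_zero.1 h with h | h
      · exact absurd h hc0
      · exact h
    rw [hx, emb2_one]; exact one_mem _
  · have hx : x ≠ 0 := by rintro rfl; simp at h
    have hq : 0 < c / x := by
      have : c / x = (c * x) / x ^ 2 := by field_simp
      rw [this]; exact div_pos (by linarith) (by positivity)
    have := hscale j i hij.symm c (Real.sqrt (c / x)) (Real.sqrt_ne_zero'.2 hq) p1
    rw [Real.sq_sqrt hq.le] at this
    convert this using 2
    field_simp

lemma emb2_mulVec (i j : ι) (a b c d : ℝ) (x : ι → ℝ) (k : ι) :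
    (emb2 i j a b c d).mulVec x k = x k + (if k = i then (a - 1) * x i + b * x j else 0)
      + (if k = j then c * x i + (d - 1) * x j else 0) := by
  simp only [emb2, Matrix.add_mulVec, Pi.add_apply, Matrix.one_mulVec, Matrix.single_mulVec,
    Function.update_apply, Pi.zero_apply]
  split_ifs <;> ring

lemma emb2_transpose (i j : ι) (a b c d : ℝ) :
    (emb2 i j a b c d).transpose = emb2 i j a c b d := by
  simp only [emb2, Matrix.transpose_add, Matrix.transpose_one, Matrix.transpose_single]
  abel

end MatrixAlgebra

section Transport

set_option linter.unusedSectionVars false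
set_option linter.unusedSimpArgs false

variable {E : Type*} [NormedAddCommGroup E] [InnerProductSpace ℝ E]

/-- `A` is the weighted parallel translation along some piecewise differentiable path
on the unit sphere of `E` from `p` to `q`. -/
def PathTransport (e₀ p q : E) (A : E → E) : Prop :=
  ∃ (T : ℝ) (σ σd : ℝ → E) (exc : Finset ℝ),
    0 < T ∧ Continuous σ ∧ (∀ t, ‖σ t‖ = 1) ∧ σ 0 = p ∧ σ T = q ∧
    (∀ t ∉ exc, HasDerivAt σ (σd t) t) ∧
    (∃ C, ∀ t ∈ Set.Icc (0 : ℝ) T, ‖σd t‖ ≤ C) ∧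
    ∀ v : E, ⟪v, p⟫ = 0 →
      ∃ X : ℝ → E,
        Continuous X ∧ X 0 = v ∧
        (∀ t, ⟪X t, σ t⟫ = 0) ∧
        (∀ t ∉ exc, HasDerivAt X
          (⟪σd t, e₀⟫ • X t + ⟪X t, e₀⟫ • σd t - ⟪X t, σd t⟫ • σ t) t) ∧
        X T = A v

lemma PathTransport.congr {e₀ p q : E} {A B : E → E} (h : PathTransport e₀ p q A)
    (hAB : ∀ v, ⟪v, p⟫ = 0 → A v = B v) : PathTransport e₀ p q B := by
  obtain ⟨T, σ, σd, exc, h1, h2, h3, h4, h5, h6, h7, h8⟩ := h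
  refine ⟨T, σ, σd, exc, h1, h2, h3, h4, h5, h6, h7, fun v hv => ?_⟩
  obtain ⟨X, a, b, c, d, e⟩ := h8 v hv
  exact ⟨X, a, b, c, d, e.trans (hAB v hv)⟩

lemma PathTransport.refl {e₀ p : E} (hp : ‖p‖ = 1) : PathTransport e₀ p p (fun v => v) := by
  refine ⟨1, fun _ => p, fun _ => 0, ∅, one_pos, continuous_const, fun _ => hp, rfl, rfl,
    fun t _ => hasDerivAt_const _ _, ⟨0, by simp⟩, fun v hv => ?_⟩
  refine ⟨fun _ => v, continuous_const, rfl, fun _ => hv, fun t _ => ?_, rfl⟩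
  simpa using hasDerivAt_const t v

/-- concatenation of functions -/
noncomputable def cat (T : ℝ) (f g : ℝ → E) (t : ℝ) : E := if t ≤ T then f t else g (t - T)

lemma cat_continuous {T : ℝ} {f g : ℝ → E} (hf : Continuous f) (hg : Continuous g)
    (h : f T = g 0) : Continuous (cat T f g) := by
  unfold cat
  refine Continuous.if_le hf (by fun_prop) continuous_id continuous_const ?_
  rintro x rfl
  simpa using h

lemma cat_left {T t : ℝ} (f g : ℝ → E) (h : t ≤ T) : cat T f g t = f t := if_pos h
lemma cat_right {T t : ℝ} (f g : ℝ → E) (h : T < t) : cat T f g t = g (t - T) := if_neg h.not_ge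

lemma cat_hasDerivAt_left {T t : ℝ} {f g : ℝ → E} {f' : E} (h : t < T)
    (hf : HasDerivAt f f' t) : HasDerivAt (cat T f g) f' t := by
  refine hf.congr_of_eventuallyEq ?_
  filter_upwards [Iio_mem_nhds h] with s hs using cat_left f g (le_of_lt hs)

lemma cat_hasDerivAt_right {T t : ℝ} {f g : ℝ → E} {g' : E} (h : T < t)
    (hg : HasDerivAt g g' (t - T)) : HasDerivAt (cat T f g) g' t := by
  refine (hg.comp_sub_const t T).congr_of_eventuallyEq ?_
  filter_upwards [Ioi_mem_nhds h] with s hs using cat_right f g hs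

lemma PathTransport.trans {e₀ p q r : E} {A B : E → E} (hA : PathTransport e₀ p q A)
    (hB : PathTransport e₀ q r B) : PathTransport e₀ p r (fun v => B (A v)) := by
  obtain ⟨T, σ, σd, exc, h1, h2, h3, h4, h5, h6, ⟨C, h7⟩, h8⟩ := hA
  obtain ⟨T', σ', σd', exc', h1', h2', h3', h4', h5', h6', ⟨C', h7'⟩, h8'⟩ := hB
  have hex : ∀ t, t ∉ insert T (exc ∪ exc'.image (· + T)) →
      (t < T ∧ t ∉ exc) ∨ (T < t ∧ t - T ∉ exc') := by
    intro t ht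
    simp only [Finset.mem_insert, Finset.mem_union, Finset.mem_image, not_or, not_exists,
      not_and] at ht
    rcases lt_or_gt_of_ne ht.1 with h | h
    · exact Or.inl ⟨h, ht.2.1⟩
    · exact Or.inr ⟨h, fun hh => ht.2.2 _ hh (by ring)⟩
  refine ⟨T + T', cat T σ σ', cat T σd σd', insert T (exc ∪ exc'.image (· + T)), by linarith,
    cat_continuous h2 h2' (h5.trans h4'.symm), ?_, ?_, ?_, ?_, ⟨max C C', ?_⟩, ?_⟩
  · intro t
    unfold cat
    split_ifs
    · exact h3 _
    · exact h3' _
  · rw [cat_left _ _ h1.le, h4]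
  · rw [cat_right _ _ (by linarith)]; simpa using h5'
  · intro t ht
    rcases hex t ht with ⟨h, h'⟩ | ⟨h, h'⟩
    · rw [cat_left _ _ h.le]; exact cat_hasDerivAt_left h (h6 t h')
    · rw [cat_right _ _ h]; exact cat_hasDerivAt_right h (h6' _ h')
  · intro t ht
    rcases le_or_gt t T with h | h
    · rw [cat_left _ _ h]; exact (h7 t ⟨ht.1, h⟩).trans (le_max_left _ _)
    · rw [cat_right _ _ h]
      exact (h7' _ ⟨by linarith, by linarith [ht.2]⟩).trans (le_max_right _ _)
  · intro v hv
    obtain ⟨X, a, b, c, d, e⟩ := h8 v hv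
    obtain ⟨X', a', b', c', d', e'⟩ := h8' (A v) (by rw [← e, ← h5]; exact c T)
    refine ⟨cat T X X', cat_continuous a a' (e.trans b'.symm), ?_, ?_, ?_, ?_⟩
    · rw [cat_left _ _ h1.le, b]
    · intro t
      rcases le_or_gt t T with h | h
      · rw [cat_left _ _ h, cat_left _ _ h]; exact c t
      · rw [cat_right _ _ h, cat_right _ _ h]; exact c' _
    · intro t ht
      rcases hex t ht with ⟨h, h'⟩ | ⟨h, h'⟩
      · simp only [cat_left _ _ h.le]; exact cat_hasDerivAt_left h (d t h')
      · simp only [cat_right _ _ h]; exact cat_hasDerivAt_right h (d' _ h')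
    · rw [cat_right _ _ (by linarith)]; simpa using e'

lemma PathTransport.map {e₀ p q : E} {A : E → E} (hA : PathTransport e₀ p q A)
    (R : E →L[ℝ] E) (R' : E → E) (hR : ∀ x y, ⟪R x, R y⟫ = ⟪x, y⟫) (hR' : ∀ x, R (R' x) = x)
    (he : R e₀ = e₀) :
    PathTransport e₀ (R p) (R q) (fun v => R (A (R' v))) := by
  have hnorm : ∀ x, ‖R x‖ = ‖x‖ := by
    intro x
    rw [← sq_eq_sq₀ (norm_nonneg _) (norm_nonneg _), ← real_inner_self_eq_norm_sq, hR,
      real_inner_self_eq_norm_sq]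
  have he' : ∀ x, ⟪R x, e₀⟫ = ⟪x, e₀⟫ := fun x => by
    conv_lhs => rw [← he]
    exact hR x e₀
  obtain ⟨T, σ, σd, exc, h1, h2, h3, h4, h5, h6, ⟨C, h7⟩, h8⟩ := hA
  refine ⟨T, fun t => R (σ t), fun t => R (σd t), exc, h1, R.continuous.comp h2,
    fun t => (hnorm _).trans (h3 t), by simp only [h4], by simp only [h5],
    fun t ht => R.hasFDerivAt.comp_hasDerivAt t (h6 t ht),
    ⟨C, fun t ht => (hnorm _).trans_le (h7 t ht)⟩, ?_⟩
  intro v hv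
  obtain ⟨X, a, b, c, d, e⟩ := h8 (R' v) (by rw [← hR, hR', hv])
  refine ⟨fun t => R (X t), R.continuous.comp a, by simp only [b, hR'],
    fun t => (hR _ _).trans (c t), fun t ht => ?_, by simp only [e]⟩
  have := R.hasFDerivAt.comp_hasDerivAt t (d t ht)
  simp only [hR, he']
  convert! this using 1
  simp only [map_sub, map_add, map_smul]

/-- Transport along a great circle. -/
lemma PathTransport.greatCircle {e₀ a b : E} (ha : ‖a‖ = 1) (hb : ‖b‖ = 1) (hab : ⟪a, b⟫ = 0)
    (T : ℝ) (hT : 0 < T) (A : E → E)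
    (hA : ∀ v, ⟪v, a⟫ = 0 → ∃ (α β : ℝ → ℝ) (w : E), ⟪w, a⟫ = 0 ∧ ⟪w, b⟫ = 0 ∧
      v = α 0 • b + β 0 • w ∧
      (∀ t, HasDerivAt α (2 * (Real.cos t * ⟪b, e₀⟫ - Real.sin t * ⟪a, e₀⟫) * α t
        + β t * ⟪w, e₀⟫) t) ∧
      (∀ t, HasDerivAt β ((Real.cos t * ⟪b, e₀⟫ - Real.sin t * ⟪a, e₀⟫) * β t) t) ∧
      A v = α T • (Real.cos T • b - Real.sin T • a) + β T • w) :
    PathTransport e₀ a (Real.cos T • a + Real.sin T • b) A := by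
  have haa : ⟪a, a⟫ = 1 := by rw [real_inner_self_eq_norm_sq, ha]; norm_num
  have hbb : ⟪b, b⟫ = 1 := by rw [real_inner_self_eq_norm_sq, hb]; norm_num
  have hba : ⟪b, a⟫ = 0 := by rw [real_inner_comm, hab]
  have hσ : ∀ t, HasDerivAt (fun t => Real.cos t • a + Real.sin t • b)
      (Real.cos t • b - Real.sin t • a) t := by
    intro t
    convert! ((Real.hasDerivAt_cos t).smul_const a).add ((Real.hasDerivAt_sin t).smul_const b) using 1
    rw [neg_smul]; abel
  have hσ' : ∀ t, HasDerivAt (fun t => Real.cos t • b - Real.sin t • a)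
      (-(Real.cos t • a + Real.sin t • b)) t := by
    intro t
    convert! ((Real.hasDerivAt_cos t).smul_const b).sub ((Real.hasDerivAt_sin t).smul_const a) using 1
    rw [neg_smul]; abel
  refine ⟨T, fun t => Real.cos t • a + Real.sin t • b, fun t => Real.cos t • b - Real.sin t • a,
    ∅, hT, by fun_prop, ?_, by simp, rfl, fun t _ => hσ t, ⟨2, ?_⟩, ?_⟩
  · intro t
    rw [← sq_eq_sq₀ (norm_nonneg _) zero_le_one, ← real_inner_self_eq_norm_sq]
    simp only [inner_add_left, inner_add_right, real_inner_smul_left, real_inner_smul_right,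
      haa, hbb, hab, hba]
    linear_combination Real.sin_sq_add_cos_sq t
  · intro t _
    refine (norm_sub_le _ _).trans ?_
    rw [norm_smul, norm_smul, ha, hb]
    have := Real.abs_cos_le_one t
    have := Real.abs_sin_le_one t
    simp only [Real.norm_eq_abs]; linarith
  · intro v hv
    obtain ⟨α, β, w, hwa, hwb, h0, hα, hβ, hfin⟩ := hA v hv
    have hd : ∀ t, HasDerivAt (fun t => α t • (Real.cos t • b - Real.sin t • a) + β t • w)
      (α t • (-(Real.cos t • a + Real.sin t • b)) +
      (2 * (Real.cos t * ⟪b, e₀⟫ - Real.sin t * ⟪a, e₀⟫) * α t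
        + β t * ⟪w, e₀⟫) • (Real.cos t • b - Real.sin t • a) +
       ((Real.cos t * ⟪b, e₀⟫ - Real.sin t * ⟪a, e₀⟫) * β t) • w) t := by
      intro t
      exact ((hα t).smul (hσ' t)).add ((hβ t).smul_const w)
    refine ⟨fun t => α t • (Real.cos t • b - Real.sin t • a) + β t • w, ?_, ?_, ?_, ?_, hfin.symm⟩
    · exact continuous_iff_continuousAt.2 fun t => (hd t).continuousAt
    · simpa using h0.symm
    · intro t
      simp only [inner_add_left, inner_sub_left, inner_add_right, real_inner_smul_left,
        real_inner_smul_right, haa, hbb, hab, hba, hwa, hwb]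
      ring
    · intro t _
      convert hd t using 1
      have hs : ⟪α t • (Real.cos t • b - Real.sin t • a) + β t • w,
          Real.cos t • b - Real.sin t • a⟫ = α t := by
        simp only [inner_add_left, inner_sub_left, inner_sub_right, real_inner_smul_left,
          real_inner_smul_right, haa, hbb, hab, hba, hwa, hwb]
        linear_combination (α t) * Real.sin_sq_add_cos_sq t
      rw [hs]
      simp only [inner_add_left, inner_sub_left, real_inner_smul_left]
      module

/-- Transport along a great circle through the pole. -/
lemma PathTransport.meridian {e₀ a b : E} (ha : ‖a‖ = 1) (hb : ‖b‖ = 1) (hab : ⟪a, b⟫ = 0)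
    (hw : ∀ w, ⟪w, a⟫ = 0 → ⟪w, b⟫ = 0 → ⟪w, e₀⟫ = 0) (T : ℝ) (hT : 0 < T) (s : ℝ)
    (hs : s = Real.cos T * ⟪a, e₀⟫ + Real.sin T * ⟪b, e₀⟫ - ⟪a, e₀⟫) :
    PathTransport e₀ a (Real.cos T • a + Real.sin T • b)
      (fun v => (Real.exp (2 * s) * ⟪v, b⟫) • (Real.cos T • b - Real.sin T • a)
        + Real.exp s • (v - ⟪v, b⟫ • b)) := by
  have hbb : ⟪b, b⟫ = 1 := by rw [real_inner_self_eq_norm_sq, hb]; norm_num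
  have hba : ⟪b, a⟫ = 0 := by rw [real_inner_comm, hab]
  refine PathTransport.greatCircle ha hb hab T hT _ ?_
  intro v hv
  have hwa : ⟪v - ⟪v, b⟫ • b, a⟫ = 0 := by
    simp [inner_sub_left, real_inner_smul_left, hv, hba]
  have hwb : ⟪v - ⟪v, b⟫ • b, b⟫ = 0 := by
    simp [inner_sub_left, real_inner_smul_left, hb]
  have hθ : ∀ t, HasDerivAt (fun t => Real.cos t * ⟪a, e₀⟫ + Real.sin t * ⟪b, e₀⟫ - ⟪a, e₀⟫)
      (Real.cos t * ⟪b, e₀⟫ - Real.sin t * ⟪a, e₀⟫) t := by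
    intro t
    convert! (((Real.hasDerivAt_cos t).mul_const ⟪a, e₀⟫).add
      ((Real.hasDerivAt_sin t).mul_const ⟪b, e₀⟫)).sub_const ⟪a, e₀⟫ using 1
    ring
  refine ⟨fun t => Real.exp (2 * (Real.cos t * ⟪a, e₀⟫ + Real.sin t * ⟪b, e₀⟫ - ⟪a, e₀⟫))
      * ⟪v, b⟫, fun t => Real.exp (Real.cos t * ⟪a, e₀⟫ + Real.sin t * ⟪b, e₀⟫ - ⟪a, e₀⟫),
      v - ⟪v, b⟫ • b, hwa, hwb, by simp, ?_, ?_, by simp only [hs]⟩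
  · intro t
    convert! (((hθ t).const_mul 2).exp.mul_const ⟪v, b⟫) using 1
    rw [hw _ hwa hwb]; ring
  · intro t
    convert! (hθ t).exp using 1
    ring

/-- Transport along a great circle in the equator. -/
lemma PathTransport.equator {e₀ a b : E} (ha : ‖a‖ = 1) (hb : ‖b‖ = 1) (hab : ⟪a, b⟫ = 0)
    (hae : ⟪a, e₀⟫ = 0) (hbe : ⟪b, e₀⟫ = 0) (T : ℝ) (hT : 0 < T) :
    PathTransport e₀ a (Real.cos T • a + Real.sin T • b)
      (fun v => (⟪v, b⟫ + T * ⟪v, e₀⟫) • (Real.cos T • b - Real.sin T • a)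
        + (v - ⟪v, b⟫ • b)) := by
  have hbb : ⟪b, b⟫ = 1 := by rw [real_inner_self_eq_norm_sq, hb]; norm_num
  have hba : ⟪b, a⟫ = 0 := by rw [real_inner_comm, hab]
  refine PathTransport.greatCircle ha hb hab T hT _ ?_
  intro v hv
  refine ⟨fun t => ⟪v, b⟫ + t * ⟪v, e₀⟫, fun _ => 1, v - ⟪v, b⟫ • b, ?_, ?_, by simp, ?_, ?_,
    by simp⟩
  · simp [inner_sub_left, real_inner_smul_left, hv, hba]
  · simp [inner_sub_left, real_inner_smul_left, hb]
  · intro t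
    convert! ((hasDerivAt_id t).mul_const ⟪v, e₀⟫).const_add ⟪v, b⟫ using 1
    simp [inner_sub_left, real_inner_smul_left, hae, hbe]
  · intro t
    simpa [hae, hbe] using hasDerivAt_const t (1 : ℝ)

/-- The basic loop at the pole. -/
lemma PathTransport.poleLoop {e₀ u v : E} (he : ‖e₀‖ = 1) (hu : ‖u‖ = 1) (hv : ‖v‖ = 1)
    (huv : ⟪u, v⟫ = 0) (hue : ⟪u, e₀⟫ = 0) (hve : ⟪v, e₀⟫ = 0) (t : ℝ) (ht : 0 < t) :
    PathTransport e₀ e₀ e₀ (fun z => ⟪z, u⟫ • (Real.cos t • u + Real.sin t • v)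
      + (⟪z, v⟫ - Real.exp (-1) * t * ⟪z, u⟫) • (Real.cos t • v - Real.sin t • u)
      + (z - ⟪z, u⟫ • u - ⟪z, v⟫ • v)) := by
  have hee : ⟪e₀, e₀⟫ = 1 := by rw [real_inner_self_eq_norm_sq, he]; norm_num
  have huu : ⟪u, u⟫ = 1 := by rw [real_inner_self_eq_norm_sq, hu]; norm_num
  have hvv : ⟪v, v⟫ = 1 := by rw [real_inner_self_eq_norm_sq, hv]; norm_num
  have heu : ⟪e₀, u⟫ = 0 := by rw [real_inner_comm, hue]
  have hev : ⟪e₀, v⟫ = 0 := by rw [real_inner_comm, hve]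
  have hvu : ⟪v, u⟫ = 0 := by rw [real_inner_comm, huv]
  have hπ : 0 < Real.pi / 2 := by positivity
  set u' := Real.cos t • u + Real.sin t • v with hu'
  have hu'1 : ‖u'‖ = 1 := by
    rw [← sq_eq_sq₀ (norm_nonneg _) zero_le_one, ← real_inner_self_eq_norm_sq, hu']
    simp only [inner_add_left, inner_add_right, real_inner_smul_left, real_inner_smul_right,
      huu, hvv, huv, hvu]
    linear_combination Real.sin_sq_add_cos_sq t
  have hu'e : ⟪u', e₀⟫ = 0 := by
    simp [hu', inner_add_left, real_inner_smul_left, hue, hve]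
  have q1 := PathTransport.meridian (e₀ := e₀) he hu heu (fun w h _ => h) (Real.pi / 2) hπ (-1)
    (by simp [he, hue])
  have q2 := PathTransport.equator hu hv huv hue hve t ht
  have q3 := PathTransport.meridian (e₀ := e₀) hu'1 he hu'e (fun w _ h => h) (Real.pi / 2) hπ 1
    (by simp [he, hu'e])
  simp only [Real.cos_pi_div_two, Real.sin_pi_div_two, zero_smul, one_smul, zero_add, zero_sub]
    at q1 q2 q3
  refine ((q1.trans q2).trans q3).congr ?_
  intro z hz
  have e1 : Real.exp 2 * Real.exp (-2) = 1 := by rw [← Real.exp_add]; simp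
  have e2 : Real.exp 1 * Real.exp (-1) = 1 := by rw [← Real.exp_add]; simp
  have e3 : Real.exp 1 * Real.exp (-2) = Real.exp (-1) := by rw [← Real.exp_add]; norm_num
  simp only [inner_add_left, inner_sub_left, real_inner_smul_left, inner_neg_left, hee, huu, hvv, hue, hve,
    heu, hev, huv, hvu, hz, smul_neg, mul_neg, mul_zero, mul_one, sub_zero, add_zero, zero_add, neg_zero]
  set x := ⟪z, u⟫
  set y := ⟪z, v⟫
  match_scalars
  · linear_combination (x * Real.cos t) * e1 - (y * Real.sin t + x) * e2
      + (t * x * Real.sin t) * e3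
  · linear_combination (x * Real.sin t) * e1 + (y * Real.cos t - y) * e2
      - (t * x * Real.cos t) * e3
  · ring
  · linear_combination e2

end Transport

section Liouville

lemma det_hasDerivAt {m : Type*} [Fintype m] [DecidableEq m] (W : ℝ → Matrix m m ℝ)
    (K : Matrix m m ℝ) (t₀ : ℝ)
    (h : ∀ i j, HasDerivAt (fun t => W t i j) ((K * W t₀) i j) t₀) :
    HasDerivAt (fun t => (W t).det) (K.trace * (W t₀).det) t₀ := by
  let f : (m → m → ℝ) → ℝ := fun M => Matrix.det (Matrix.of M)
  have hf : Differentiable ℝ f := by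
    have : f = fun M => ∑ σ : Equiv.Perm m, ((Equiv.Perm.sign σ : ℤ) : ℝ) * ∏ i, M (σ i) i := by
      funext M
      simp [f, Matrix.det_apply']
    rw [this]
    fun_prop
  have h1 : HasDerivAt (fun t => f (fun i j => W t i j))
      (fderiv ℝ f (fun i j => W t₀ i j) (fun i j => (K * W t₀) i j)) t₀ := by
    refine (hf _).hasFDerivAt.comp_hasDerivAt (f := fun t => (fun i j => W t i j)) t₀ ?_
    exact hasDerivAt_pi.2 fun i => hasDerivAt_pi.2 fun j => h i j
  have h2 : HasDerivAt (fun s : ℝ => f (fun i j => W t₀ i j + s * (K * W t₀) i j))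
      (fderiv ℝ f (fun i j => W t₀ i j) (fun i j => (K * W t₀) i j)) 0 := by
    have hh : HasFDerivAt f (fderiv ℝ f (fun i j => W t₀ i j))
      ((fun s : ℝ => (fun i j => W t₀ i j + s * (K * W t₀) i j)) 0) := by
      simpa using (hf (fun i j => W t₀ i j)).hasFDerivAt
    refine hh.comp_hasDerivAt (f := fun s : ℝ => (fun i j => W t₀ i j + s * (K * W t₀) i j)) 0 ?_
    refine hasDerivAt_pi.2 fun i => hasDerivAt_pi.2 fun j => ?_
    simpa using ((hasDerivAt_id (0:ℝ)).mul_const ((K * W t₀) i j)).const_add (W t₀ i j)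
  have h3 : HasDerivAt (fun s : ℝ => f (fun i j => W t₀ i j + s * (K * W t₀) i j))
      (K.trace * (W t₀).det) 0 := by
    have e : (fun s : ℝ => f (fun i j => W t₀ i j + s * (K * W t₀) i j)) = fun s =>
        (1 + K.trace * s + (Matrix.det (1 + (Polynomial.X : Polynomial ℝ) •
          K.map Polynomial.C)).divX.divX.eval s * s ^ 2) * (W t₀).det := by
      funext s
      rw [← Matrix.det_one_add_smul, ← Matrix.det_mul]
      rw [add_mul, one_mul, smul_mul_assoc]
      rfl
    rw [e]
    have := ((((hasDerivAt_id (0:ℝ)).const_mul K.trace).const_add 1).add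
      (((Matrix.det (1 + (Polynomial.X : Polynomial ℝ) •
          K.map Polynomial.C)).divX.divX.hasDerivAt (0:ℝ)).mul (hasDerivAt_pow 2 (0:ℝ)))).mul_const
          (W t₀).det
    simpa using this
  rw [← h2.unique h3]
  exact h1

/-- Liouville formula for the transport: determinants are preserved up to the density. -/
lemma transport_det {n : ℕ} {e₀ : EuclideanSpace ℝ (Fin (n + 1))} {T : ℝ}
    {σ σd : ℝ → EuclideanSpace ℝ (Fin (n + 1))} {exc : Finset ℝ} (hσc : Continuous σ)
    (hσ1 : ∀ t, ‖σ t‖ = 1) (hσT : σ T = σ 0) (hσd : ∀ t ∉ exc, HasDerivAt σ (σd t) t)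
    (X : Fin n → ℝ → EuclideanSpace ℝ (Fin (n + 1))) (hXc : ∀ k, Continuous (X k))
    (hXσ : ∀ k t, ⟪X k t, σ t⟫ = 0)
    (hX : ∀ k, ∀ t ∉ exc, HasDerivAt (X k)
          (⟪σd t, e₀⟫ • X k t + ⟪X k t, e₀⟫ • σd t - ⟪X k t, σd t⟫ • σ t) t) :
    (Matrix.of fun i j => (Fin.cons (σ T) (fun k => X k T) : Fin (n+1) → EuclideanSpace ℝ (Fin (n + 1))) j i).det
    = (Matrix.of fun i j => (Fin.cons (σ 0) (fun k => X k 0) : Fin (n+1) → EuclideanSpace ℝ (Fin (n + 1))) j i).det := by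
  set W : ℝ → Matrix (Fin (n+1)) (Fin (n+1)) ℝ := fun t =>
    Matrix.of fun i j => (Fin.cons (σ t) (fun k => X k t) : Fin (n+1) → EuclideanSpace ℝ (Fin (n + 1))) j i with hW
  change (W T).det = (W 0).det
  have hWc : Continuous fun t => (W t).det := by
    refine Continuous.matrix_det ?_
    refine continuous_matrix fun i j => ?_
    refine Fin.cases ?_ (fun k => ?_) j
    · simp only [hW, Matrix.of_apply, Fin.cons_zero]; fun_prop
    · simp only [hW, Matrix.of_apply, Fin.cons_succ]; have := hXc k; fun_prop
  have inn : ∀ x y : EuclideanSpace ℝ (Fin (n+1)), ⟪x, y⟫ = ∑ i, x i * y i := by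
    intro x y; simp [PiLp.inner_apply, mul_comm]
  have hσσ : ∀ t, ⟪σ t, σ t⟫ = 1 := fun t => by rw [real_inner_self_eq_norm_sq, hσ1]; norm_num
  have hperp : ∀ t ∉ exc, ⟪σ t, σd t⟫ = 0 := by
    intro t ht
    have h1 := (hσd t ht).inner ℝ (hσd t ht)
    have h2 : HasDerivAt (fun t => ⟪σ t, σ t⟫) 0 t := by
      simp only [hσσ]; exact hasDerivAt_const _ _
    have := h1.unique h2
    rw [real_inner_comm (σ t) (σd t)] at this
    linarith
  have hder : ∀ t ∉ exc, HasDerivAt (fun t => (W t).det) (((n : ℝ) + 1) * ⟪σd t, e₀⟫ * (W t).det) t := by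
    intro t ht
    set K : Matrix (Fin (n+1)) (Fin (n+1)) ℝ := Matrix.of fun i j =>
      ⟪σd t, e₀⟫ * ((if i = j then 1 else 0) - σ t i * σ t j)
        + σd t i * (e₀ j - ⟪σ t, e₀⟫ * σ t j) - σ t i * σd t j + σd t i * σ t j with hK
    have hKmul : ∀ (Y : EuclideanSpace ℝ (Fin (n+1))) i, ∑ j, K i j * Y j =
        ⟪σd t, e₀⟫ * (Y i - σ t i * ⟪Y, σ t⟫)
        + σd t i * (⟪Y, e₀⟫ - ⟪σ t, e₀⟫ * ⟪Y, σ t⟫) - σ t i * ⟪Y, σd t⟫ + σd t i * ⟪Y, σ t⟫ := by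
      intro Y i
      have e : ∀ j, K i j * Y j = ⟪σd t, e₀⟫ * (if i = j then Y j else 0)
        - ⟪σd t, e₀⟫ * σ t i * (Y j * σ t j)
        + σd t i * (Y j * e₀ j) - σd t i * ⟪σ t, e₀⟫ * (Y j * σ t j) - σ t i * (Y j * σd t j)
        + σd t i * (Y j * σ t j) := by
        intro j
        simp only [hK, Matrix.of_apply]
        split_ifs <;> ring
      simp only [e, Finset.sum_add_distrib, Finset.sum_sub_distrib, ← Finset.mul_sum, ← inn]
      simp
      ring
    have hKtr : K.trace = ((n : ℝ) + 1) * ⟪σd t, e₀⟫ := by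
      have e : ∀ i, K i i = ⟪σd t, e₀⟫ - ⟪σd t, e₀⟫ * (σ t i * σ t i) + σd t i * e₀ i
        - ⟪σ t, e₀⟫ * (σ t i * σd t i) := by
        intro i
        simp only [hK, Matrix.of_apply, if_true]; ring
      simp only [Matrix.trace, Matrix.diag_apply, e, Finset.sum_add_distrib, Finset.sum_sub_distrib,
        ← Finset.mul_sum]
      rw [← inn, ← inn, ← inn, hσσ, hperp t ht]
      simp
    rw [← hKtr]
    apply det_hasDerivAt
    have comp : ∀ {f : ℝ → EuclideanSpace ℝ (Fin (n+1))} {f'} (i : Fin (n+1)),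
        HasDerivAt f f' t → HasDerivAt (fun t => f t i) (f' i) t := by
      intro f f' i hf
      exact (EuclideanSpace.proj (𝕜 := ℝ) i).hasFDerivAt.comp_hasDerivAt t hf
    intro i j
    refine Fin.cases ?_ (fun k => ?_) j
    · have := hKmul (σ t) i
      rw [Matrix.mul_apply]
      simp only [hW, Matrix.of_apply, Fin.cons_zero]
      rw [this, hσσ, hperp t ht]
      convert comp i (hσd t ht) using 1
      ring
    · have := hKmul (X k t) i
      rw [Matrix.mul_apply]
      simp only [hW, Matrix.of_apply, Fin.cons_succ]
      rw [this, hXσ]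
      convert comp i (hX k t ht) using 1
      simp
      ring
  set F : ℝ → ℝ := fun t => Real.exp (-(((n : ℝ) + 1) * ⟪σ t, e₀⟫)) * (W t).det with hF
  have hFc : Continuous F := by
    refine Continuous.mul ?_ hWc
    fun_prop
  have hFd : ∀ t ∉ exc, HasDerivAt F 0 t := by
    intro t ht
    have h1 : HasDerivAt (fun t => ⟪σ t, e₀⟫) ⟪σd t, e₀⟫ t := by
      simpa using (hσd t ht).inner ℝ (hasDerivAt_const t e₀)
    convert! ((h1.const_mul ((n : ℝ) + 1)).neg.exp).mul (hder t ht) using 1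
    ring
  have := MeasureTheory.integral_eq_of_hasDerivAt_off_countable F (fun _ => 0) (a := 0) (b := T)
    (s := (exc : Set ℝ)) exc.countable_toSet hFc.continuousOn
    (fun x hx => hFd x (by simpa using hx.2)) (by simp)
  simp only [intervalIntegral.integral_zero] at this
  have h2 : F T = F 0 := by linarith
  simp only [hF, hσT] at h2
  exact mul_left_cancel₀ (Real.exp_pos _).ne' h2

end Liouville

section Pole

/-- Inclusion of `ℝⁿ` as the tangent space at the pole. -/
noncomputable def liftVec {n : ℕ} (x : Fin n → ℝ) : EuclideanSpace ℝ (Fin (n + 1)) :=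
  WithLp.toLp 2 (Fin.cons 0 x)

/-- Coordinates on the tangent space at the pole. -/
def tailVec {n : ℕ} (x : EuclideanSpace ℝ (Fin (n + 1))) : Fin n → ℝ := fun i => x i.succ

/-- The pole. -/
noncomputable def pole (n : ℕ) : EuclideanSpace ℝ (Fin (n + 1)) := EuclideanSpace.single 0 1

@[simp] lemma liftVec_zero {n : ℕ} (x : Fin n → ℝ) : liftVec x 0 = 0 := rfl
@[simp] lemma liftVec_succ {n : ℕ} (x : Fin n → ℝ) (i : Fin n) : liftVec x i.succ = x i := rfl
@[simp] lemma tailVec_liftVec {n : ℕ} (x : Fin n → ℝ) : tailVec (liftVec x) = x := rfl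

lemma inner_pole {n : ℕ} (x : EuclideanSpace ℝ (Fin (n + 1))) : ⟪x, pole n⟫ = x 0 := by
  simp [pole, EuclideanSpace.inner_single_right]

lemma norm_pole (n : ℕ) : ‖pole n‖ = 1 := by simp [pole]

lemma liftVec_tailVec {n : ℕ} {x : EuclideanSpace ℝ (Fin (n + 1))} (h : ⟪x, pole n⟫ = 0) :
    liftVec (tailVec x) = x := by
  rw [inner_pole] at h
  ext i
  refine Fin.cases ?_ (fun k => ?_) i
  · simp [h]
  · rfl

/-- The holonomy at the pole, in coordinates. -/
noncomputable def poleGroup (n : ℕ) : Submonoid (Matrix (Fin n) (Fin n) ℝ) where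
  carrier := {M | PathTransport (pole n) (pole n) (pole n)
    (fun x => liftVec (M.mulVec (tailVec x)))}
  one_mem' := by
    refine (PathTransport.refl (norm_pole n)).congr ?_
    intro v hv
    simp [liftVec_tailVec hv]
  mul_mem' := by
    intro a b ha hb
    refine (PathTransport.trans hb ha).congr ?_
    intro v hv
    simp [Matrix.mulVec_mulVec]

lemma poleGroup_conj {n : ℕ} (O O' : Matrix (Fin n) (Fin n) ℝ) (hO : O.transpose = O')
    (h1 : O * O' = 1) (h2 : O' * O = 1) (M : Matrix (Fin n) (Fin n) ℝ) (hM : M ∈ poleGroup n) :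
    O * M * O' ∈ poleGroup n := by
  let Rf : Matrix (Fin n) (Fin n) ℝ → EuclideanSpace ℝ (Fin (n + 1)) →
    EuclideanSpace ℝ (Fin (n + 1)) := fun Q x => WithLp.toLp 2 (Fin.cons (x 0) (Q.mulVec (tailVec x)))
  have R0 : ∀ Q x, Rf Q x 0 = x 0 := fun _ _ => rfl
  have R1 : ∀ Q x (i : Fin n), Rf Q x i.succ = Q.mulVec (tailVec x) i := fun _ _ _ => rfl
  let L : EuclideanSpace ℝ (Fin (n + 1)) →ₗ[ℝ] EuclideanSpace ℝ (Fin (n + 1)) :=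
    { toFun := Rf O
      map_add' := by
        intro x y
        have : tailVec (x + y) = tailVec x + tailVec y := rfl
        ext i
        refine Fin.cases ?_ (fun k => ?_) i
        · simp [R0]
        · simp [R1, this, Matrix.mulVec_add]
      map_smul' := by
        intro c x
        have : tailVec (c • x) = c • tailVec x := rfl
        ext i
        refine Fin.cases ?_ (fun k => ?_) i
        · simp [R0]
        · simp [R1, this, Matrix.mulVec_smul] }
  have hL : ∀ x, L.toContinuousLinearMap x = Rf O x := fun _ => rfl
  have hpole : Rf O (pole n) = pole n := by
    have : tailVec (pole n) = 0 := by
      funext i; simp [tailVec, pole]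
    ext i
    refine Fin.cases ?_ (fun k => ?_) i
    · rfl
    · rw [R1, this]; simp [pole]
  have hinner : ∀ x y, ⟪Rf O x, Rf O y⟫ = ⟪x, y⟫ := by
    have key : ∀ a b : Fin n → ℝ, ∑ i, O.mulVec b i * O.mulVec a i = ∑ i, b i * a i := by
      intro a b
      change dotProduct (O.mulVec b) (O.mulVec a) = dotProduct b a
      rw [Matrix.dotProduct_mulVec, ← Matrix.mulVec_transpose, Matrix.mulVec_mulVec, hO, h2,
        Matrix.one_mulVec]
    intro x y
    simp only [PiLp.inner_apply, RCLike.inner_apply, conj_trivial, Fin.sum_univ_succ, R0, R1, key]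
    rfl
  have := PathTransport.map (e₀ := pole n) hM L.toContinuousLinearMap (Rf O') hinner ?_ hpole
  · rw [hL, hpole] at this
    refine this.congr ?_
    intro v hv
    rw [hL]
    have t1 : tailVec (Rf O' v) = O'.mulVec (tailVec v) := rfl
    ext i
    refine Fin.cases ?_ (fun k => ?_) i
    · rw [R0]; rfl
    · rw [R1, liftVec_succ, tailVec_liftVec, t1]
      simp [Matrix.mulVec_mulVec, mul_assoc]
  · intro x
    rw [hL]
    have t1 : tailVec (Rf O' x) = O'.mulVec (tailVec x) := rfl
    ext i
    refine Fin.cases ?_ (fun k => ?_) i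
    · rfl
    · rw [R1, t1, Matrix.mulVec_mulVec, h1, Matrix.one_mulVec]; rfl

lemma poleGroup_loop_pos {n : ℕ} {i j : Fin n} (hij : i ≠ j) (s t : ℝ) (hs : s * s = 1)
    (ht : 0 < t) :
    emb2 i j (Real.cos t + Real.sin t * (Real.exp (-1) * t)) (-(s * Real.sin t))
      (s * Real.sin t - s * (Real.cos t * (Real.exp (-1) * t))) (Real.cos t) ∈ poleGroup n := by
  have hs1 : |s| = 1 := by
    rw [← abs_mul_self] at hs
    have := abs_nonneg s
    rw [abs_mul] at hs
    nlinarith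
  have hsucc : i.succ ≠ j.succ := fun h => hij (Fin.succ_injective _ h)
  have iu : ∀ x : EuclideanSpace ℝ (Fin (n + 1)), ∀ k, ⟪x, EuclideanSpace.single k (1 : ℝ)⟫ = x k := by
    intro x k; simp [EuclideanSpace.inner_single_right]
  have := PathTransport.poleLoop (e₀ := pole n) (u := EuclideanSpace.single i.succ (1 : ℝ))
    (v := s • EuclideanSpace.single j.succ (1 : ℝ)) (norm_pole n) (by simp)
    (by simp [norm_smul, hs1]) (by rw [real_inner_smul_right, iu]; simp [hsucc.symm])
    (by rw [inner_pole]; simp) (by rw [inner_pole]; simp) t ht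
  refine this.congr ?_
  intro z hz
  simp only [real_inner_smul_right, iu]
  rw [inner_pole] at hz
  ext k
  refine Fin.cases ?_ (fun l => ?_) k
  · simp [hz]
  · rw [liftVec_succ, emb2_mulVec]
    simp only [PiLp.add_apply, PiLp.sub_apply, PiLp.smul_apply, EuclideanSpace.single_apply,
      Fin.succ_inj, smul_eq_mul, tailVec]
    by_cases h1 : l = i
    · subst h1
      simp only [hij, if_true, if_false]
      linear_combination (-(Real.sin t * z j.succ)) * 0
    · by_cases h2 : l = j
      · subst h2
        simp only [h1, if_true, if_false]
        linear_combination ((Real.cos t - 1) * z l.succ) * hs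
      · simp [h1, h2]

lemma det_one_mem_poleGroup {n : ℕ} (M : Matrix (Fin n) (Fin n) ℝ) (hM : M.det = 1) :
    M ∈ poleGroup n := by
  refine det_one_mem_of_twisted (poleGroup n) (Real.exp (-1)) (Real.exp_pos _).ne' ?_ ?_ M hM
  · intro i j hij t
    rcases lt_trichotomy t 0 with h | h | h
    · have := poleGroup_loop_pos hij (-1) (-t) (by norm_num) (by linarith)
      simp only [Real.cos_neg, Real.sin_neg] at this
      convert this using 2 <;> ring
    · subst h
      simpa [emb2_one] using one_mem (poleGroup n)
    · have := poleGroup_loop_pos hij 1 t (by norm_num) h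
      simpa only [one_mul] using this
  · intro i j hij t M hM
    have cs := Real.sin_sq_add_cos_sq t
    refine poleGroup_conj _ _ (emb2_transpose _ _ _ _ _ _) ?_ ?_ M hM
    · rw [emb2_mul hij, ← emb2_one i j]
      congr 1
      · linear_combination cs
      · ring
      · ring
      · linear_combination cs
    · rw [emb2_mul hij, ← emb2_one i j]
      congr 1
      · linear_combination cs
      · ring
      · ring
      · linear_combination cs

end Pole

section Final

lemma exists_polar {n : ℕ} (hn : 2 ≤ n) (p : EuclideanSpace ℝ (Fin (n + 1))) (hp : ‖p‖ = 1) :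
    ∃ (θ : ℝ) (u : EuclideanSpace ℝ (Fin (n + 1))), 0 < θ ∧ ‖u‖ = 1 ∧ ⟪u, pole n⟫ = 0 ∧
      p = Real.cos θ • pole n + Real.sin θ • u := by
  have hee : ⟪pole n, pole n⟫ = 1 := by rw [real_inner_self_eq_norm_sq, norm_pole]; norm_num
  have hpp : ⟪p, p⟫ = 1 := by rw [real_inner_self_eq_norm_sq, hp]; norm_num
  -- first find `u` and coefficients
  obtain ⟨u, c, s, hu, hue, hps⟩ : ∃ (u : EuclideanSpace ℝ (Fin (n + 1))) (c s : ℝ), ‖u‖ = 1 ∧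
      ⟪u, pole n⟫ = 0 ∧ p = c • pole n + s • u := by
    by_cases h : p - ⟪p, pole n⟫ • pole n = 0
    · refine ⟨EuclideanSpace.single (Fin.succ ⟨0, by omega⟩) 1, ⟪p, pole n⟫, 0, by simp, ?_, ?_⟩
      · rw [inner_pole]; simp
      · simpa using sub_eq_zero.1 h
    · have hne : ‖p - ⟪p, pole n⟫ • pole n‖ ≠ 0 := norm_ne_zero_iff.2 h
      refine ⟨‖p - ⟪p, pole n⟫ • pole n‖⁻¹ • (p - ⟪p, pole n⟫ • pole n), ⟪p, pole n⟫,
        ‖p - ⟪p, pole n⟫ • pole n‖, ?_, ?_, ?_⟩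
      · rw [norm_smul, norm_inv, norm_norm, inv_mul_cancel₀ hne]
      · rw [real_inner_smul_left, inner_sub_left, real_inner_smul_left, hee]; ring
      · rw [smul_smul, mul_inv_cancel₀ hne]; simp
  have huu : ⟪u, u⟫ = 1 := by rw [real_inner_self_eq_norm_sq, hu]; norm_num
  have heu : ⟪pole n, u⟫ = 0 := by rw [real_inner_comm, hue]
  have hcs : c ^ 2 + s ^ 2 = 1 := by
    rw [hps] at hpp
    simp only [inner_add_left, inner_add_right, real_inner_smul_left, real_inner_smul_right,
      hee, huu, hue, heu] at hpp
    linarith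
  have hz : ‖(⟨c, s⟩ : ℂ)‖ = 1 := by
    rw [← sq_eq_sq₀ (norm_nonneg _) zero_le_one, Complex.sq_norm, Complex.normSq_mk]
    linarith
  have hz0 : (⟨c, s⟩ : ℂ) ≠ 0 := by
    intro h; rw [h] at hz; simp at hz
  refine ⟨Complex.arg ⟨c, s⟩ + 2 * Real.pi, u, ?_, hu, hue, ?_⟩
  · have := Complex.neg_pi_lt_arg ⟨c, s⟩
    have := Real.pi_pos
    linarith
  · rw [Real.cos_add_two_pi, Real.sin_add_two_pi, Complex.cos_arg hz0, Complex.sin_arg, hz]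
    simpa using hps

lemma exists_transport_to_pole {n : ℕ} (hn : 2 ≤ n) (p : EuclideanSpace ℝ (Fin (n + 1)))
    (hp : ‖p‖ = 1) : ∃ (A : EuclideanSpace ℝ (Fin (n + 1)) →ₗ[ℝ] EuclideanSpace ℝ (Fin (n + 1)))
      (B : EuclideanSpace ℝ (Fin (n + 1)) → EuclideanSpace ℝ (Fin (n + 1))),
      PathTransport (pole n) p (pole n) A ∧ PathTransport (pole n) (pole n) p B ∧
      (∀ v, ⟪v, p⟫ = 0 → ⟪A v, pole n⟫ = 0) ∧ (∀ v, ⟪v, p⟫ = 0 → B (A v) = v) := by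
  obtain ⟨θ, u, hθ, hu, hue, hpu⟩ := exists_polar hn p hp
  have hee : ⟪pole n, pole n⟫ = 1 := by rw [real_inner_self_eq_norm_sq, norm_pole]; norm_num
  have huu : ⟪u, u⟫ = 1 := by rw [real_inner_self_eq_norm_sq, hu]; norm_num
  have heu : ⟪pole n, u⟫ = 0 := by rw [real_inner_comm, hue]
  have cs := Real.sin_sq_add_cos_sq θ
  set b := Real.sin θ • pole n - Real.cos θ • u with hb
  have e1 : pole n = Real.cos θ • p + Real.sin θ • b := by
    rw [hb, hpu]
    match_scalars
    · linear_combination -cs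
    · ring
  have e2 : u = Real.sin θ • p - Real.cos θ • b := by
    rw [hb, hpu]
    match_scalars
    · linear_combination -cs
    · ring
  have hb1 : ‖b‖ = 1 := by
    rw [← sq_eq_sq₀ (norm_nonneg _) zero_le_one, ← real_inner_self_eq_norm_sq, hb]
    simp only [inner_sub_left, inner_sub_right, real_inner_smul_left, real_inner_smul_right,
      huu, hee, hue, heu]
    linear_combination cs
  have hbb : ⟪b, b⟫ = 1 := by rw [real_inner_self_eq_norm_sq, hb1]; norm_num
  have hpb : ⟪p, b⟫ = 0 := by
    rw [hb, hpu]
    simp only [inner_add_left, inner_sub_right, real_inner_smul_left, real_inner_smul_right,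
      huu, hee, hue, heu]
    ring
  have hpe : ⟪p, pole n⟫ = Real.cos θ := by
    rw [hpu]; simp only [inner_add_left, real_inner_smul_left, hee, hue]; ring
  have hbe : ⟪b, pole n⟫ = Real.sin θ := by
    rw [hb]; simp only [inner_sub_left, real_inner_smul_left, hee, hue]; ring
  have hbp : ⟪b, p⟫ = 0 := by rw [real_inner_comm, hpb]
  have hbu : ⟪b, u⟫ = -Real.cos θ := by
    rw [hb]; simp only [inner_sub_left, real_inner_smul_left, huu, heu]; ring
  have q1 := PathTransport.meridian (e₀ := pole n) hp hb1 hpb (fun w h h' => by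
    rw [e1, inner_add_right, real_inner_smul_right, real_inner_smul_right, h, h']; ring) θ hθ
    (1 - Real.cos θ) (by rw [hpe, hbe]; linear_combination -cs)
  have q2 := PathTransport.meridian (e₀ := pole n) (norm_pole n) hu heu (fun w h _ => h) θ hθ
    (-(1 - Real.cos θ)) (by rw [hee, hue]; ring)
  rw [← e1] at q1
  rw [← hpu] at q2
  set s := 1 - Real.cos θ with hs
  have hv : ∀ v, ⟪v, p⟫ = 0 → ⟪v, pole n⟫ = Real.sin θ * ⟪v, b⟫ := by
    intro v h
    conv_lhs => rw [e1]
    rw [inner_add_right, real_inner_smul_right, real_inner_smul_right, h]; ring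
  have hv' : ∀ v, ⟪v, p⟫ = 0 → ⟪v, u⟫ = - (Real.cos θ * ⟪v, b⟫) := by
    intro v h
    conv_lhs => rw [e2]
    rw [inner_sub_right, real_inner_smul_right, real_inner_smul_right, h]; ring
  have hub : Real.cos θ • b - Real.sin θ • p = -u := by rw [e2]; abel
  have hub' : Real.cos θ • u - Real.sin θ • pole n = -b := by rw [hb]; abel
  rw [hub] at q1
  rw [hub'] at q2
  refine ⟨{ toFun := fun v => (Real.exp (2 * s) * ⟪v, b⟫) • -u + Real.exp s • (v - ⟪v, b⟫ • b)
            map_add' := ?_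
            map_smul' := ?_ }, _, q1, q2, ?_, ?_⟩
  · intro x y
    rw [inner_add_left]; module
  · intro c x
    rw [real_inner_smul_left]
    simp only [RingHom.id_apply]; module
  · intro v h
    simp only [LinearMap.coe_mk, AddHom.coe_mk, inner_add_left, inner_sub_left, inner_neg_left,
      real_inner_smul_left, hue, hbe, hv v h]
    ring
  · intro v h
    have x1 : Real.exp (2 * -s) * Real.exp (2 * s) = 1 := by rw [← Real.exp_add]; simp
    have x2 : Real.exp (-s) * Real.exp s = 1 := by rw [← Real.exp_add]; simp
    have hi : ⟪(Real.exp (2 * s) * ⟪v, b⟫) • -u + Real.exp s • (v - ⟪v, b⟫ • b), u⟫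
        = - (Real.exp (2 * s) * ⟪v, b⟫) := by
      simp only [inner_add_left, inner_sub_left, inner_neg_left,
        real_inner_smul_left, huu, hbu, hv' v h]
      ring
    simp only [LinearMap.coe_mk, AddHom.coe_mk, hi]
    set y := ⟪v, b⟫
    have : v = y • b + (v - y • b) := by abel
    conv_rhs => rw [this]
    calc _ = ((Real.exp (2 * -s) * Real.exp (2 * s)) * y) • b
          + (Real.exp (-s) * Real.exp s) • (v - y • b) := by module
      _ = _ := by rw [x1, x2]; simp

end Final

lemma gram_apply {m : ℕ} (a b : Fin m → EuclideanSpace ℝ (Fin m)) (i j : Fin m) :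
    ((Matrix.of fun i j => a j i : Matrix (Fin m) (Fin m) ℝ).transpose *
      (Matrix.of fun i j => b j i : Matrix (Fin m) (Fin m) ℝ)) i j = ⟪a i, b j⟫ := by
  rw [Matrix.mul_apply]
  simp only [Matrix.transpose_apply, Matrix.of_apply, PiLp.inner_apply, RCLike.inner_apply,
    conj_trivial]
  exact Finset.sum_congr rfl (fun k _ => mul_comm _ _)

set_option maxHeartbeats 2000000 in
theorem weighted_holonomy_of_round_sphere_with_density_is_SL (n : ℕ) (hn : 2 ≤ n)
    (e₀ : EuclideanSpace ℝ (Fin (n + 1))) (he₀ : e₀ = EuclideanSpace.single 0 1)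
    (p : EuclideanSpace ℝ (Fin (n + 1))) (hp : ‖p‖ = 1) :
    {A : ↥((Submodule.span ℝ {p})ᗮ) →ₗ[ℝ] ↥((Submodule.span ℝ {p})ᗮ) |
        IsSphereWeightedLoopTransport n e₀ p A}
      = {A | LinearMap.det A = 1} := by
  have hp0 : p ≠ 0 := by rintro rfl; simp at hp
  haveI : Fact (Module.finrank ℝ (EuclideanSpace ℝ (Fin (n + 1))) = n + 1) := ⟨by simp⟩
  have hfr : Module.finrank ℝ ↥((Submodule.span ℝ {p})ᗮ) = n :=
    Submodule.finrank_orthogonal_span_singleton hp0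
  have hperp : ∀ v : ↥((Submodule.span ℝ {p})ᗮ), ⟪(v : EuclideanSpace ℝ (Fin (n + 1))), p⟫ = 0 :=
    fun v => Submodule.mem_orthogonal_singleton_iff_inner_left.1 v.2
  have hpp : ⟪p, p⟫ = 1 := by rw [real_inner_self_eq_norm_sq, hp]; norm_num
  ext A
  simp only [Set.mem_setOf_eq]
  constructor
  · rintro ⟨T, σ, σd, exc, h1, h2, h3, h4, h5, h6, -, h8⟩
    let ob := OrthonormalBasis.fromOrthogonalSpanSingleton (𝕜 := ℝ) n hp0
    choose X hXc hX0 hXσ hXd hXT using h8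
    have key := transport_det (e₀ := e₀) h2 h3 (h5.trans h4.symm) h6 (fun k => X (ob k))
      (fun k => hXc _) (fun k => hXσ _) (fun k => hXd _)
    simp only [hXT, hX0, h4, h5] at key
    set W : (Fin n → ↥((Submodule.span ℝ {p})ᗮ)) → Matrix (Fin (n + 1)) (Fin (n + 1)) ℝ :=
      fun f => Matrix.of fun i j => (Fin.cons p (fun k => (f k : EuclideanSpace ℝ (Fin (n + 1)))) :
        Fin (n+1) → EuclideanSpace ℝ (Fin (n + 1))) j i with hW
    change (W fun k => A (ob k)).det = (W fun k => ob k).det at key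
    have hprod : ∀ f, ((W fun k => ob k).transpose * W f).det
        = (Matrix.of fun i j => ⟪ob i, f j⟫).det := by
      intro f
      have ent : ∀ i j, ((W fun k => ob k).transpose * W f) i j =
          ⟪(Fin.cons p (fun k => (ob k : EuclideanSpace ℝ (Fin (n + 1)))) :
        Fin (n+1) → EuclideanSpace ℝ (Fin (n + 1))) i,
            (Fin.cons p (fun k => (f k : EuclideanSpace ℝ (Fin (n + 1)))) :
        Fin (n+1) → EuclideanSpace ℝ (Fin (n + 1))) j⟫ := by
        intro i j
        exact gram_apply _ _ i j
      rw [Matrix.det_succ_column_zero, Fin.sum_univ_succ]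
      have z : ∀ i : Fin n, ((W fun k => ob k).transpose * W f) i.succ 0 = 0 := by
        intro i; rw [ent]; simp only [Fin.cons_succ, Fin.cons_zero]; exact hperp _
      have o : ((W fun k => ob k).transpose * W f) 0 0 = 1 := by
        rw [ent]; simp only [Fin.cons_zero]; exact hpp
      simp only [z, o]
      simp only [mul_zero, zero_mul, Finset.sum_const_zero, add_zero, Fin.val_zero, pow_zero, one_mul]
      congr 1
      ext i j
      rw [Matrix.submatrix_apply, Fin.succAbove_zero, ent]
      simp
    have d1 := hprod (fun k => ob k)
    have d2 := hprod (fun k => A (ob k))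
    rw [Matrix.det_mul, key] at d2
    rw [Matrix.det_mul] at d1
    have m1 : (Matrix.of fun i j => ⟪ob i, ob j⟫ : Matrix (Fin n) (Fin n) ℝ) = 1 := by
      ext i j
      simp [ob.inner_eq_ite, Matrix.one_apply]
    have m2 : (Matrix.of fun i j => ⟪ob i, A (ob j)⟫ : Matrix (Fin n) (Fin n) ℝ)
        = LinearMap.toMatrix ob.toBasis ob.toBasis A := by
      ext i j
      simp [LinearMap.toMatrix_apply, OrthonormalBasis.repr_apply_apply]
    rw [m1, Matrix.det_one] at d1
    rw [m2, LinearMap.det_toMatrix] at d2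
    rw [← d2, d1]
  · intro hA
    obtain ⟨P, B, hP, hB, hPe, hBP⟩ := exists_transport_to_pole hn p hp
    let L : ↥((Submodule.span ℝ {p})ᗮ) →ₗ[ℝ] (Fin n → ℝ) :=
      { toFun := fun v => tailVec (P v)
        map_add' := by intro x y; funext i; simp [tailVec]
        map_smul' := by intro c x; funext i; simp [tailVec] }
    have hL : ∀ v, liftVec (L v) = P v := fun v => liftVec_tailVec (hPe v (hperp v))
    have hinj : Function.Injective L := by
      intro x y hxy
      have : P x = P y := by rw [← hL, ← hL, hxy]
      apply Subtype.ext
      rw [← hBP x (hperp x), ← hBP y (hperp y), this]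
    let e := LinearMap.linearEquivOfInjective L hinj (by rw [hfr]; simp)
    have he : ∀ v, e v = L v := fun v => LinearMap.linearEquivOfInjective_apply _ _ v
    set M : Matrix (Fin n) (Fin n) ℝ := LinearMap.toMatrix' ((e : ↥((Submodule.span ℝ {p})ᗮ) →ₗ[ℝ] (Fin n → ℝ)) ∘ₗ A ∘ₗ (e.symm : (Fin n → ℝ) →ₗ[ℝ] ↥((Submodule.span ℝ {p})ᗮ))) with hM
    have hdet : M.det = 1 := by
      rw [hM, LinearMap.det_toMatrix', LinearMap.det_conj, hA]
    have hMv : ∀ v, M.mulVec (L v) = L (A v) := by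
      intro v
      rw [hM, LinearMap.toMatrix'_mulVec, ← he, ← he]
      simp
    have hPT : PathTransport (pole n) (pole n) (pole n) (fun x => liftVec (M.mulVec (tailVec x))) :=
      det_one_mem_poleGroup M hdet
    obtain ⟨T, σ, σd, exc, h1, h2, h3, h4, h5, h6, h7, h8⟩ := (hP.trans hPT).trans hB
    have he' : e₀ = pole n := he₀
    rw [he']
    refine ⟨T, σ, σd, exc, h1, h2, h3, h4, h5, h6, h7, fun v => ?_⟩
    obtain ⟨X, a, b, c, d, f⟩ := h8 v (hperp v)
    refine ⟨X, a, b, c, d, f.trans ?_⟩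
    change B (liftVec (M.mulVec (L v))) = A v
    rw [hMv, hL, hBP _ (hperp _)]
end

section
/- Consider ℝⁿ with the Levi-Civita–type metric g = Σ_i Π_i dx_i² built from one-variable functions φ₁ < ⋯ < φₙ with A_i = 1, where φₙ(xₙ) = n + cos xₙ and φ₁,…,φₙ₋₁ are pairwise distinct nonzero constants less than n−1, exactly p of them negative and q−1 of them positive (so p + q = n), Π_i = (φ_i−φ₁)⋯(φ_i−φ_{i−1})(φ_{i+1}−φ_i)⋯(φₙ−φ_i), and density φ = ½ log|φ₁⋯φₙ|. Then the holonomy group of the weighted connection ∇^φ of (ℝⁿ, g, φ) is precisely SO⁺(p,q). -/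
/-- The partial derivative `∂f/∂x_i` of a function on `ℝⁿ`. -/
noncomputable def partialD {n : ℕ} (i : Fin n) (f : (Fin n → ℝ) → ℝ)
    (x : Fin n → ℝ) : ℝ :=
  deriv (fun s => f (Function.update x i s)) (x i)

/-- The Christoffel symbols `Γᵏᵢⱼ` of a diagonal (pseudo-Riemannian) metric
`g = Σ_i G_i dx_i²` on `ℝⁿ`, from the standard formula
`Γᵏᵢⱼ = ½ gᵏˡ (∂_i g_{jl} + ∂_j g_{il} − ∂_l g_{ij})`. -/
noncomputable def diagChristoffel {n : ℕ} (G : Fin n → (Fin n → ℝ) → ℝ)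
    (k i j : Fin n) (x : Fin n → ℝ) : ℝ :=
  if i = j then
    (if k = i then partialD i (G i) x / (2 * G i x)
     else -partialD k (G i) x / (2 * G k x))
  else if k = i then partialD j (G i) x / (2 * G i x)
  else if k = j then partialD i (G j) x / (2 * G j x)
  else 0

/-- The factor `Π_i = (φ_i−φ₁)⋯(φ_i−φ_{i−1})·(φ_{i+1}−φ_i)⋯(φ_n−φ_i)` of the
Levi-Civita construction, where `φ_l` is a function of the coordinate `x_l` alone. -/
noncomputable def lcProd {n : ℕ} (φf : Fin n → ℝ → ℝ) (i : Fin n)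
    (x : Fin n → ℝ) : ℝ :=
  (∏ l ∈ Finset.univ.filter (fun l => l < i), (φf i (x i) - φf l (x l))) *
  (∏ l ∈ Finset.univ.filter (fun l => i < l), (φf l (x l) - φf i (x i)))

section Helpers
set_option linter.all false

open Matrix Topology Filter

namespace HolAux

/-! ### Elementary rotations and boosts -/

/-- `cos` or `cosh`, according to the sign. -/
noncomputable def cF (e : ℝ) (s : ℝ) : ℝ := if e = 1 then Real.cos s else Real.cosh s

/-- `sin` or `sinh`, according to the sign. -/
noncomputable def sF (e : ℝ) (s : ℝ) : ℝ := if e = 1 then Real.sin s else Real.sinh s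

lemma cF_zero (e : ℝ) : cF e 0 = 1 := by unfold cF; split_ifs <;> simp
lemma sF_zero (e : ℝ) : sF e 0 = 0 := by unfold sF; split_ifs <;> simp
lemma cF_neg (e s : ℝ) : cF e (-s) = cF e s := by unfold cF; split_ifs <;> simp
lemma sF_neg (e s : ℝ) : sF e (-s) = - sF e s := by unfold sF; split_ifs <;> simp
lemma sF_one (e : ℝ) : sF e 1 ≠ 0 := by
  unfold sF; split_ifs
  · exact (Real.sin_pos_of_pos_of_lt_pi one_pos (by linarith [Real.pi_gt_three])).ne'
  · exact (Real.sinh_pos_iff.2 one_pos).ne'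

lemma cF_sq (e s : ℝ) (he : e = 1 ∨ e = -1) : cF e s ^ 2 + e * sF e s ^ 2 = 1 := by
  rcases he with rfl | rfl
  · simp [cF, sF]
  · have h : (-1 : ℝ) ≠ 1 := by norm_num
    simp only [cF, sF, h, if_false]
    linarith [Real.cosh_sq s]

lemma cF_deriv (e s : ℝ) (he : e = 1 ∨ e = -1) : HasStrictDerivAt (cF e) (-e * sF e s) s := by
  rcases he with rfl | rfl
  · have h1 : cF 1 = Real.cos := by ext; simp [cF]
    have h2 : sF 1 = Real.sin := by ext; simp [sF]
    rw [h1, h2]; simpa using Real.hasStrictDerivAt_cos s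
  · have h : (-1 : ℝ) ≠ 1 := by norm_num
    have h1 : cF (-1) = Real.cosh := by ext; simp [cF, h]
    have h2 : sF (-1) = Real.sinh := by ext; simp [sF, h]
    rw [h1, h2]; simpa using Real.hasStrictDerivAt_cosh s

lemma sF_deriv (e s : ℝ) (he : e = 1 ∨ e = -1) : HasStrictDerivAt (sF e) (cF e s) s := by
  rcases he with rfl | rfl
  · have h1 : cF 1 = Real.cos := by ext; simp [cF]
    have h2 : sF 1 = Real.sin := by ext; simp [sF]
    rw [h1, h2]; simpa using Real.hasStrictDerivAt_sin s
  · have h : (-1 : ℝ) ≠ 1 := by norm_num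
    have h1 : cF (-1) = Real.cosh := by ext; simp [cF, h]
    have h2 : sF (-1) = Real.sinh := by ext; simp [sF, h]
    rw [h1, h2]; simpa using Real.hasStrictDerivAt_sinh s

variable {ι : Type*} [Fintype ι] [DecidableEq ι]

/-- The generator of the rotation / boost in the `(i,j)`-plane. -/
def eM (J : ι → ℝ) (i j : ι) : Matrix ι ι ℝ :=
  single i j 1 - single j i (J i * J j)

/-- The projector to the `(i,j)`-plane. -/
def qM (i j : ι) : Matrix ι ι ℝ := single i i 1 + single j j 1

/-- The rotation / boost in the `(i,j)`-plane. -/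
noncomputable def rM (J : ι → ℝ) (i j : ι) (s : ℝ) : Matrix ι ι ℝ :=
  1 + (cF (J i * J j) s - 1) • qM i j + sF (J i * J j) s • eM J i j

lemma eps_or (J : ι → ℝ) (hJ : ∀ i, J i * J i = 1) (i j : ι) :
    J i * J j = 1 ∨ J i * J j = -1 := by
  have h : (J i * J j) * (J i * J j) = 1 := by
    calc _ = (J i * J i) * (J j * J j) := by ring
      _ = 1 := by rw [hJ, hJ]; ring
  exact mul_self_eq_one_iff.1 h

lemma eM_mul_qM (J : ι → ℝ) {i j : ι} (hij : i ≠ j) : eM J i j * qM i j = eM J i j := by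
  simp [eM, qM, sub_mul, mul_add, single_mul_single_of_ne, hij, hij.symm]
  abel

lemma qM_mul_eM (J : ι → ℝ) {i j : ι} (hij : i ≠ j) : qM i j * eM J i j = eM J i j := by
  simp [eM, qM, mul_sub, add_mul, single_mul_single_of_ne, hij, hij.symm]

lemma qM_mul_qM {i j : ι} (hij : i ≠ j) : qM i j * qM i j = qM i j := by
  simp [qM, mul_add, add_mul, single_mul_single_of_ne, hij, hij.symm]

lemma eM_mul_eM (J : ι → ℝ) {i j : ι} (hij : i ≠ j) :
    eM J i j * eM J i j = (-(J i * J j)) • qM i j := by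
  simp [eM, qM, mul_sub, sub_mul, single_mul_single_of_ne, hij, hij.symm]
  abel

lemma rM_zero (J : ι → ℝ) (i j : ι) : rM J i j 0 = 1 := by
  simp [rM, cF_zero, sF_zero]

lemma rM_neg_mul (J : ι → ℝ) (hJ : ∀ i, J i * J i = 1) {i j : ι} (hij : i ≠ j) (s : ℝ) :
    rM J i j (-s) * rM J i j s = 1 := by
  have h := cF_sq _ s (eps_or J hJ i j)
  simp only [rM, cF_neg, sF_neg, add_mul, mul_add, smul_mul_assoc, mul_smul_comm, one_mul, mul_one,
    eM_mul_qM J hij, qM_mul_eM J hij, qM_mul_qM hij, eM_mul_eM J hij]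
  generalize cF (J i * J j) s = C at *
  generalize sF (J i * J j) s = S at *
  have : C ^ 2 = 1 - J i * J j * S ^ 2 := by linarith
  match_scalars <;> first | ring1 | linear_combination this

lemma rM_adj (J : ι → ℝ) (hJ : ∀ i, J i * J i = 1) (i j : ι) (s : ℝ) :
    (rM J i j s)ᵀ * diagonal J = diagonal J * rM J i j (-s) := by
  have d1 : ∀ (a b : ι) (c : ℝ), single a b c * diagonal J = single a b (c * J b) := by
    intro a b c
    ext x y
    simp only [mul_diagonal, single, of_apply]
    split_ifs with h
    · rw [h.2]
    · simp
  have d2 : ∀ (a b : ι) (c : ℝ), diagonal J * single a b c = single a b (J a * c) := by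
    intro a b c
    ext x y
    simp only [diagonal_mul, single, of_apply]
    split_ifs with h
    · rw [h.1]
    · simp
  have h1 : (eM J i j)ᵀ * diagonal J = - (diagonal J * eM J i j) := by
    have e1 : J i * J j * J j = J i := by rw [mul_assoc, hJ, mul_one]
    have e3 : J j * (J i * J j) = J i := by rw [mul_left_comm, hJ, mul_one]
    simp [eM, sub_mul, mul_sub, d1, d2, e1, e3]
  have h2 : (qM i j)ᵀ * diagonal J = diagonal J * qM i j := by
    simp [qM, add_mul, mul_add, d1, d2]
  simp only [rM, cF_neg, sF_neg, transpose_add, transpose_smul, transpose_one, add_mul, mul_add,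
    smul_mul_assoc, mul_smul_comm, h1, h2, one_mul, mul_one, smul_neg, neg_smul, mul_neg]

lemma rM_mem (J : ι → ℝ) (hJ : ∀ i, J i * J i = 1) {i j : ι} (hij : i ≠ j) (s : ℝ) :
    (rM J i j s)ᵀ * diagonal J * rM J i j s = diagonal J := by
  rw [rM_adj J hJ, mul_assoc, rM_neg_mul J hJ hij, mul_one]

/-- The derivative of the coordinates of the rotation. -/
lemma rM_eM (J : ι → ℝ) {i j : ι} (hij : i ≠ j) (s : ℝ) :
    eM J i j * rM J i j s
      = (-(J i * J j) * sF (J i * J j) s) • qM i j + cF (J i * J j) s • eM J i j := by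
  simp only [rM, mul_add, mul_smul_comm, mul_one,
    eM_mul_qM J hij, eM_mul_eM J hij]
  module

/-- Conjugating a generator. -/
lemma rM_conj (J : ι → ℝ) (hJ : ∀ i, J i * J i = 1) {i j N : ι} (hij : i ≠ j) (hi : i ≠ N)
    (hj : j ≠ N) (s : ℝ) :
    rM J j N s * eM J i N * rM J j N (-s)
      = cF (J j * J N) s • eM J i N + (sF (J j * J N) s * (J j * J N)) • eM J i j := by
  have h1 : rM J j N s * eM J i N = single i N 1 - (cF (J j * J N) s * (J i * J N)) • single N i 1
      - (sF (J j * J N) s * (J i * J N)) • single j i 1 := by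
    simp only [rM, eM, qM]
    simp [add_mul, mul_add, sub_mul, mul_sub, single_mul_single_of_ne, hij, hij.symm, hi, hj,
      hi.symm, hj.symm, smul_sub]
    ext a b
    simp [single]
    split_ifs <;> ring1
  rw [h1]
  simp only [rM, eM, qM, cF_neg, sF_neg]
  simp [add_mul, mul_add, sub_mul, mul_sub, single_mul_single_of_ne, hij, hij.symm, hi, hj,
      hi.symm, hj.symm, smul_sub]
  have h2 : J j * J N * (J i * J j) = J i * J N := by
    linear_combination (J i * J N) * hJ j
  ext a b
  simp [single]
  split_ifs <;> first | ring1 | linear_combination (sF (J j * J N) s) * h2 | linear_combination (-sF (J j * J N) s) * h2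

end HolAux

namespace HolAux

/-! ### The monoid generated by the rotations and boosts -/

/-- The monoid generated by the rotations / boosts in the `(i,N)`-planes. -/
def mon {ι : Type*} [Fintype ι] [DecidableEq ι] (J : ι → ℝ) (N : ι) :
    Submonoid (Matrix ι ι ℝ) :=
  Submonoid.closure {B | ∃ i, i ≠ N ∧ ∃ s, B = rM J i N s}

lemma rM_mem_mon {ι : Type*} [Fintype ι] [DecidableEq ι] (J : ι → ℝ) (N : ι) {i : ι}
    (hi : i ≠ N) (s : ℝ) : rM J i N s ∈ mon J N :=
  Submonoid.subset_closure ⟨i, hi, s, rfl⟩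

lemma mon_orth {ι : Type*} [Fintype ι] [DecidableEq ι] (J : ι → ℝ) (hJ : ∀ i, J i * J i = 1)
    (N : ι) {B : Matrix ι ι ℝ} (hB : B ∈ mon J N) : Bᵀ * diagonal J * B = diagonal J := by
  induction hB using Submonoid.closure_induction with
  | mem x hx =>
    obtain ⟨i, hi, s, rfl⟩ := hx
    exact rM_mem J hJ hi s
  | one => simp
  | mul x y _ _ hx hy =>
    calc (x * y)ᵀ * diagonal J * (x * y) = yᵀ * (xᵀ * diagonal J * x) * y := by
          rw [transpose_mul]; simp only [mul_assoc]
      _ = _ := by rw [hx, hy]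

section Abstract

variable {A : Type*} [NormedRing A] [NormedAlgebra ℝ A]

lemma curve_deriv (q e : A) (ε s : ℝ) (hε : ε = 1 ∨ ε = -1) :
    HasStrictDerivAt (fun t => 1 + (cF ε t - 1) • q + sF ε t • e)
      ((-ε * sF ε s) • q + cF ε s • e) s := by
  have h1 := HasStrictDerivAt.smul_const (HasDerivAtFilter.sub_const 1 (cF_deriv ε s hε)) q
  have h2 := HasStrictDerivAt.smul_const (sF_deriv ε s hε) e
  exact HasDerivAtFilter.add (HasDerivAtFilter.const_add 1 h1) h2

lemma scale_curve (g : ℝ → A) (e : A) (hg : HasStrictDerivAt g e 0) (c : ℝ) :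
    HasStrictDerivAt (fun s => g (c * s)) (c • e) 0 := by
  have h2 : HasStrictDerivAt (fun s : ℝ => c * s) c 0 := by
    simpa using (hasStrictDerivAt_id (0 : ℝ)).const_mul c
  have h1 : HasStrictDerivAt g e (c * 0) := by simpa using hg
  exact HasStrictDerivAt.scomp (0 : ℝ) h1 h2

lemma conj_curve (R R' : A) (hR : R * R' = 1) (g : ℝ → A) (e : A) (g0 : g 0 = 1)
    (hg : HasStrictDerivAt g e 0) (a b : ℝ) :
    HasStrictDerivAt (fun s => R * g (a * s) * R' * g (b * s))
      (a • (R * e * R') + b • e) 0 := by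
  have h1 := (((scale_curve g e hg a).const_mul R).mul_const R').fun_mul (scale_curve g e hg b)
  convert h1 using 1
  simp [g0, hR]

lemma listProd_deriv {E κ : Type*} [NormedAddCommGroup E] [NormedSpace ℝ E]
    (l : List κ) (f : κ → E → A) (f' : κ → E →L[ℝ] A)
    (h0 : ∀ k, f k 0 = 1) (hf : ∀ k, HasStrictFDerivAt (f k) (f' k) 0) :
    (l.map (fun k => f k 0)).prod = 1 ∧
    HasStrictFDerivAt (fun x => (l.map (fun k => f k x)).prod) ((l.map f').sum) 0 := by
  induction l with
  | nil => simpa using hasStrictFDerivAt_const (1 : A) (0 : E)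
  | cons k l ih =>
    refine ⟨by simp [h0], ?_⟩
    simp only [List.map_cons, List.prod_cons, List.sum_cons]
    have h1 := HasStrictFDerivAt.fun_mul' (hf k) ih.2
    rw [ih.1, h0] at h1
    refine h1.congr_fderiv ?_
    ext x
    simp [add_comm]

lemma abstract_local [CompleteSpace A] {κ : Type*} [Fintype κ] (ent : κ → A →L[ℝ] ℝ) (e : κ → A)
    (sym : A →L[ℝ] A) (hdec : ∀ M, (∑ k, ent k M • e k) + sym M = M) (g : κ → ℝ → A)
    (g0 : ∀ k, g k 0 = 1) (gd : ∀ k, HasStrictDerivAt (g k) (e k) 0) :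
    Filter.map (fun M => ((Finset.univ.toList).map (fun k => g k (ent k M))).prod * (1 + sym M))
      (𝓝 0) = 𝓝 1 := by
  set l : List κ := Finset.univ.toList with hl
  let f : κ → A → A := fun k M => g k (ent k M)
  let f' : κ → A →L[ℝ] A := fun k => (ent k).smulRight (e k)
  have hf0 : ∀ k, f k 0 = 1 := by intro k; simp [f, g0]
  have hf : ∀ k, HasStrictFDerivAt (f k) (f' k) 0 := by
    intro k
    have h1 : HasStrictFDerivAt (g k) (ContinuousLinearMap.toSpanSingleton ℝ (e k)) (ent k 0) := by
      rw [map_zero]; exact (gd k).hasStrictFDerivAt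
    have h3 : HasStrictFDerivAt (fun M => ent k M) (ent k) 0 := (ent k).hasStrictFDerivAt
    have h2 := h1.comp (0 : A) h3
    refine h2.congr_fderiv ?_
    ext x
    simp [f']
  obtain ⟨hp, hd⟩ := listProd_deriv l f f' hf0 hf
  have hS : HasStrictFDerivAt (fun M => 1 + sym M) sym 0 := by
    have h0 : HasStrictFDerivAt (fun M => sym M) sym 0 := sym.hasStrictFDerivAt
    exact h0.const_add 1
  have hF := HasStrictFDerivAt.fun_mul' hd hS
  have hF' : HasStrictFDerivAt (fun M => (l.map (fun k => f k M)).prod * (1 + sym M))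
      ((ContinuousLinearEquiv.refl ℝ A : A →L[ℝ] A)) 0 := by
    refine hF.congr_fderiv ?_
    rw [hp]
    ext M
    have e1 : (l.map f').sum M = ∑ k, ent k M • e k := by
      have : (l.map f').sum = ∑ k, f' k := by
        simp only [hl, Finset.sum_map_toList]
      rw [this, ContinuousLinearMap.sum_apply]
      rfl
    have := hdec M
    simp [e1]
    rw [add_comm]; exact this
  have hmap := hF'.map_nhds_eq_of_equiv
  simp only [hp, map_zero, add_zero, mul_one] at hmap
  exact hmap

end Abstract

/-- Square matrices with a norm. -/
def Mat (ι : Type*) := Matrix ι ι ℝ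

section Norm

variable {ι : Type*} [Fintype ι] [DecidableEq ι]

noncomputable instance : NormedRing (Mat ι) := Matrix.linftyOpNormedRing
noncomputable instance : NormedAlgebra ℝ (Mat ι) := Matrix.linftyOpNormedAlgebra
instance : FiniteDimensional ℝ (Mat ι) :=
  inferInstanceAs (FiniteDimensional ℝ (Matrix ι ι ℝ))
instance : CompleteSpace (Mat ι) := FiniteDimensional.complete ℝ (Mat ι)

lemma rM_deriv_zero (J : ι → ℝ) (hJ : ∀ i, J i * J i = 1) (i j : ι) :
    HasStrictDerivAt (F := Mat ι) (rM J i j) (eM J i j) 0 := by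
  have h := curve_deriv (A := Mat ι) (qM i j) (eM J i j) (J i * J j) 0 (eps_or J hJ i j)
  have h2 : eM J i j = (-(J i * J j) * sF (J i * J j) 0) • qM i j
      + cF (J i * J j) 0 • eM J i j := by
    rw [sF_zero, cF_zero, mul_zero, zero_smul, one_smul, zero_add]
  rw [h2]
  exact h

/-- every generator is the velocity of a curve in the monoid -/
lemma exists_curve (J : ι → ℝ) (hJ : ∀ i, J i * J i = 1) (N : ι) (i j : ι) :
    ∃ g : ℝ → Mat ι, g 0 = 1 ∧ HasStrictDerivAt (F := Mat ι) g (eM J i j) 0 ∧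
      ∀ s, (show Matrix ι ι ℝ from g s) ∈ mon J N := by
  by_cases hij : i = j
  · subst hij
    refine ⟨fun _ => 1, rfl, ?_, fun _ => one_mem _⟩
    have : eM J i i = (0 : Matrix ι ι ℝ) := by simp [eM, hJ]
    rw [this]
    exact hasStrictDerivAt_const (F := Mat ι) _ _
  by_cases hjN : j = N
  · subst hjN
    exact ⟨rM J i j, rM_zero _ _ _, rM_deriv_zero J hJ i j, rM_mem_mon J j hij⟩
  by_cases hiN : i = N
  · subst hiN
    refine ⟨fun s => rM J j i (-(J i * J j) * s), ?_, ?_,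
      fun s => rM_mem_mon J i hjN _⟩
    · change rM J j i (-(J i * J j) * 0) = (1 : Matrix ι ι ℝ)
      rw [mul_zero, rM_zero]
    have h3 := scale_curve (A := Mat ι) _ _ (rM_deriv_zero J hJ j i) (-(J i * J j))
    have h4 : J i * J j * (J j * J i) = 1 := by
      linear_combination (J i * J i) * hJ j + hJ i
    have h5 : eM J i j = (-(J i * J j)) • eM J j i := by
      ext a b
      simp [eM, single, smul_sub, mul_sub]
      split_ifs <;> linarith
    rw [h5]
    exact h3
  · set β := sF (J j * J N) 1 * (J j * J N) with hβ
    have hβ0 : β ≠ 0 := by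
      refine mul_ne_zero (sF_one _) ?_
      rcases eps_or J hJ j N with h | h <;> rw [h] <;> norm_num
    set α := cF (J j * J N) 1 with hα
    have hone : rM J j N 1 * rM J j N (-1) = 1 := by
      have := rM_neg_mul J hJ hjN (-1)
      rwa [neg_neg] at this
    have h1 := conj_curve (A := Mat ι) (rM J j N 1) (rM J j N (-1)) hone (rM J i N) _
      (rM_zero J i N) (rM_deriv_zero J hJ i N) β⁻¹ (-(β⁻¹ * α))
    refine ⟨fun s => (show Matrix ι ι ℝ from
      rM J j N 1 * rM J i N (β⁻¹ * s) * rM J j N (-1) * rM J i N (-(β⁻¹ * α) * s)), ?_, ?_, ?_⟩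
    · change rM J j N 1 * rM J i N (β⁻¹ * 0) * rM J j N (-1) * rM J i N (-(β⁻¹ * α) * 0)
        = (1 : Matrix ι ι ℝ)
      rw [mul_zero, mul_zero, rM_zero, mul_one, mul_one, hone]
    · have h2 : eM J i j = β⁻¹ • (rM J j N 1 * eM J i N * rM J j N (-1))
          + (-(β⁻¹ * α)) • eM J i N := by
        rw [rM_conj J hJ hij hiN hjN, ← hα, ← hβ, smul_add, smul_smul, smul_smul,
          inv_mul_cancel₀ hβ0]
        module
      rw [h2]
      exact h1
    · intro s
      exact mul_mem (mul_mem (mul_mem (rM_mem_mon J N hjN _) (rM_mem_mon J N hiN _))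
        (rM_mem_mon J N hjN _)) (rM_mem_mon J N hiN _)

/-- The symmetric part. -/
noncomputable def symL (J : ι → ℝ) : Matrix ι ι ℝ →ₗ[ℝ] Matrix ι ι ℝ where
  toFun := fun M => (1/2 : ℝ) • (M + diagonal J * Mᵀ * diagonal J)
  map_add' := by
    intro x y; simp only [transpose_add, mul_add, add_mul, ← smul_add]; congr 1; abel
  map_smul' := by
    intro c x
    simp only [transpose_smul, mul_smul_comm, smul_mul_assoc, ← smul_add, RingHom.id_apply]
    rw [smul_comm]

lemma symL_dec (J : ι → ℝ) (M : Matrix ι ι ℝ) :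
    (∑ k : ι × ι, ((1/2 : ℝ) * M k.1 k.2) • eM J k.1 k.2) + symL J M = M := by
  have e1 : (∑ k : ι × ι, ((1/2 : ℝ) * M k.1 k.2) • eM J k.1 k.2)
      = (1/2 : ℝ) • (M - diagonal J * Mᵀ * diagonal J) := by
    rw [Fintype.sum_prod_type]
    ext a b
    simp only [Matrix.sum_apply]
    simp [eM, single, mul_sub, Finset.sum_sub_distrib, ite_and, Finset.sum_ite_eq]
    ring
  have e2 : symL J M = (1/2 : ℝ) • (M + diagonal J * Mᵀ * diagonal J) := rfl
  rw [e1, e2]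
  module

lemma local_surj (J : ι → ℝ) (hJ : ∀ i, J i * J i = 1) (N : ι) :
    ∃ h : Matrix ι ι ℝ → Matrix ι ι ℝ, (∀ M, h M ∈ mon J N) ∧
      Filter.map (fun M => h M * (1 + symL J M)) (𝓝 (0 : Matrix ι ι ℝ)) = 𝓝 1 := by
  choose g g0 gd gm using exists_curve J hJ N
  let ent : ι × ι → (Mat ι →L[ℝ] ℝ) := fun k =>
    LinearMap.toContinuousLinearMap (E := Mat ι) (F' := ℝ) (𝕜 := ℝ)
      ((1/2 : ℝ) • (Matrix.entryLinearMap ℝ ℝ k.1 k.2))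
  let sym : Mat ι →L[ℝ] Mat ι :=
    LinearMap.toContinuousLinearMap (E := Mat ι) (F' := Mat ι) (𝕜 := ℝ) (symL J)
  have key := abstract_local (A := Mat ι) ent (fun k => eM J k.1 k.2) sym
    (fun M => symL_dec J M) (fun k => g k.1 k.2) (fun k => g0 k.1 k.2) (fun k => gd k.1 k.2)
  refine ⟨fun M => (((Finset.univ : Finset (ι × ι)).toList).map
    (fun k => (show Matrix ι ι ℝ from g k.1 k.2 (ent k M)))).prod, ?_, key⟩
  intro M
  apply Submonoid.list_prod_mem
  intro x hx
  obtain ⟨k, -, rfl⟩ := List.mem_map.1 hx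
  exact gm _ _ _

lemma isUnit_near (J : ι → ℝ) : ∀ᶠ M in 𝓝 (0 : Matrix ι ι ℝ), IsUnit (2 + symL J M) := by
  have hc : Continuous (fun M : Matrix ι ι ℝ => (2 + symL J M).det) := by
    have : Continuous (fun M : Matrix ι ι ℝ => 2 + symL J M) := by
      change Continuous (fun M : Matrix ι ι ℝ => 2 + (1/2 : ℝ) • (M + diagonal J * Mᵀ * diagonal J))
      fun_prop
    exact this.matrix_det
  have h0 : (2 + symL J (0 : Matrix ι ι ℝ)).det ≠ 0 := by
    have : (2 : Matrix ι ι ℝ) = (2 : ℝ) • 1 := by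
      rw [two_smul]; norm_num
    rw [map_zero, add_zero, this, det_smul]
    simp
  filter_upwards [hc.continuousAt.eventually_ne h0] with M hM
  rw [isUnit_iff_isUnit_det]
  exact isUnit_iff_ne_zero.2 hM

end Norm

lemma local_mem {ι : Type*} [Fintype ι] [DecidableEq ι]
    (J : ι → ℝ) (hJ : ∀ i, J i * J i = 1) (N : ι) :
    ∀ᶠ B in 𝓝 (1 : Matrix ι ι ℝ), Bᵀ * diagonal J * B = diagonal J → B ∈ mon J N := by
  have hDD : diagonal J * diagonal J = (1 : Matrix ι ι ℝ) := by
    rw [diagonal_mul_diagonal, ← diagonal_one]; congr 1; ext i; exact hJ i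
  obtain ⟨h, hmem, hmap⟩ := local_surj J hJ N
  rw [← hmap, Filter.eventually_map]
  filter_upwards [isUnit_near J] with M hM hB
  have hmem := hmem M
  have ho := mon_orth J hJ N hmem
  have hs : (symL J M)ᵀ * diagonal J = diagonal J * symL J M := by
    change ((1/2 : ℝ) • (M + diagonal J * Mᵀ * diagonal J))ᵀ * diagonal J
      = diagonal J * ((1/2 : ℝ) • (M + diagonal J * Mᵀ * diagonal J))
    simp only [transpose_smul, transpose_add, transpose_mul, transpose_transpose,
      diagonal_transpose, smul_mul_assoc, mul_smul_comm, add_mul, mul_add]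
    congr 1
    simp only [← mul_assoc, hDD, one_mul]
    simp only [mul_assoc, hDD, mul_one]
    abel
  generalize symL J M = S at *
  have h1 : (1 + S)ᵀ * diagonal J * (1 + S) = diagonal J := by
    rw [transpose_mul] at hB
    calc (1 + S)ᵀ * diagonal J * (1 + S)
        = (1 + S)ᵀ * ((h M)ᵀ * diagonal J * h M)
            * (1 + S) := by rw [ho]
      _ = (1 + S)ᵀ * (h M)ᵀ * diagonal J * (h M * (1 + S)) := by simp only [mul_assoc]
      _ = _ := hB
  have h2 : diagonal J * ((1 + S) * (1 + S)) = diagonal J := by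
    refine Eq.trans ?_ h1
    have h6 : (1 + S)ᵀ * diagonal J = diagonal J * (1 + S) := by
      rw [transpose_add, transpose_one, add_mul, hs, mul_add, one_mul, mul_one]
    rw [h6, mul_assoc]
  have h3 : (1 + S) * (1 + S) = 1 := by
    have := congrArg (fun X => diagonal J * X) h2
    simpa only [← mul_assoc, hDD, one_mul] using this
  have h4 : (2 + S) * S = 0 := by
    have : (2 + S) * S = (1 + S) * (1 + S) - 1 := by noncomm_ring
    rw [this, h3, sub_self]
  have h5 : S = 0 := by
    exact (hM.mul_right_eq_zero).1 h4
  rw [h5]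
  simpa using hmem

theorem comp_subset {ι : Type*} [Fintype ι] [DecidableEq ι] (J : ι → ℝ)
    (hJ : ∀ i, J i * J i = 1) (N : ι) :
    connectedComponentIn {B : Matrix ι ι ℝ | Bᵀ * diagonal J * B = diagonal J} 1 ⊆ mon J N := by
  intro B hB
  have hDD : diagonal J * diagonal J = (1 : Matrix ι ι ℝ) := by
    rw [diagonal_mul_diagonal, ← diagonal_one]; congr 1; ext i; exact hJ i
  set O := {B : Matrix ι ι ℝ | Bᵀ * diagonal J * B = diagonal J} with hO
  have h1O : (1 : Matrix ι ι ℝ) ∈ O := by simp [hO]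
  have hsub : connectedComponentIn O 1 ⊆ O := connectedComponentIn_subset _ _
  have hinv : ∀ x ∈ O, x * (diagonal J * xᵀ * diagonal J) = 1 := by
    intro x hx
    have h : (diagonal J * xᵀ * diagonal J) * x = 1 := by
      have hx' : xᵀ * diagonal J * x = diagonal J := hx
      calc (diagonal J * xᵀ * diagonal J) * x = diagonal J * (xᵀ * diagonal J * x) := by
            simp only [mul_assoc]
        _ = 1 := by rw [hx', hDD]
    exact mul_eq_one_comm.1 h
  have hinvO : ∀ x ∈ O, ∀ y ∈ O, (diagonal J * xᵀ * diagonal J) * y ∈ O := by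
    intro x hx y hy
    have hx' : x * (diagonal J * xᵀ * diagonal J) = 1 := hinv x hx
    have hy' : yᵀ * diagonal J * y = diagonal J := hy
    change ((diagonal J * xᵀ * diagonal J) * y)ᵀ * diagonal J * ((diagonal J * xᵀ * diagonal J) * y)
      = diagonal J
    simp only [transpose_mul, transpose_transpose, diagonal_transpose]
    calc yᵀ * (diagonal J * (x * diagonal J)) * diagonal J * (diagonal J * xᵀ * diagonal J * y)
        = yᵀ * diagonal J * (x * (diagonal J * diagonal J) * (diagonal J * xᵀ * diagonal J)) * y
          := by simp only [mul_assoc]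
      _ = _ := by rw [hDD, mul_one, hx', mul_one, hy']
  have key := (isPreconnected_connectedComponentIn (F := O) (x := (1 : Matrix ι ι ℝ))).induction₂'
    (fun x y => ∃ Z ∈ mon J N, y = x * Z) ?_ ?_ (mem_connectedComponentIn h1O) hB
  · obtain ⟨Z, hZ, rfl⟩ := key
    simpa using hZ
  · intro x hx
    have hx' := hsub hx
    have hloc := local_mem J hJ N
    have c1 : Tendsto (fun y : Matrix ι ι ℝ => (diagonal J * xᵀ * diagonal J) * y) (𝓝 x) (𝓝 1) := by
      have : Continuous (fun y : Matrix ι ι ℝ => (diagonal J * xᵀ * diagonal J) * y) := by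
        fun_prop
      have h := this.tendsto x
      rwa [mul_eq_one_comm.1 (hinv x hx')] at h
    have c2 : Tendsto (fun y : Matrix ι ι ℝ => (diagonal J * yᵀ * diagonal J) * x) (𝓝 x) (𝓝 1) := by
      have : Continuous (fun y : Matrix ι ι ℝ => (diagonal J * yᵀ * diagonal J) * x) := by
        fun_prop
      have h := this.tendsto x
      rwa [mul_eq_one_comm.1 (hinv x hx')] at h
    filter_upwards [nhdsWithin_le_nhds (c1.eventually hloc), nhdsWithin_le_nhds (c2.eventually hloc),
      self_mem_nhdsWithin] with y h1 h2 hy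
    have hy' := hsub hy
    refine ⟨⟨_, h1 (hinvO x hx' y hy'), ?_⟩, ⟨_, h2 (hinvO y hy' x hx'), ?_⟩⟩
    · rw [← mul_assoc, hinv x hx', one_mul]
    · rw [← mul_assoc, hinv y hy', one_mul]
  · rintro x y z - - - ⟨Z, hZ, rfl⟩ ⟨Z', hZ', rfl⟩
    exact ⟨Z * Z', mul_mem hZ hZ', by rw [mul_assoc]⟩

end HolAux

namespace HolAux

/-! ### Parallel transport in an orthonormal frame -/

section Frame

variable {ι : Type*} [Fintype ι] [DecidableEq ι]

/-- The right-hand side of the parallel transport equation in an orthonormal frame. -/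
def wRHS (J : ι → ℝ) (N : ι) (κ : ι → ℝ → ℝ) (x xd w : ι → ℝ) : ι → ℝ := fun k =>
  if k = N then ∑ i, (if i = N then 0 else J i * J N * κ i (x N) * xd i * w i)
  else -(κ k (x N) * xd k * w N)

/-- The holonomy set of an ODE with right-hand side `rhs`. -/
def HolSet (rhs : (ι → ℝ) → (ι → ℝ) → (ι → ℝ) → (ι → ℝ)) (B : Matrix ι ι ℝ) : Prop :=
  ∃ (T : ℝ) (σ σd : ℝ → ι → ℝ) (exc : Finset ℝ),
    0 < T ∧ Continuous σ ∧ σ 0 = 0 ∧ σ T = 0 ∧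
    (∀ t ∉ exc, HasDerivAt σ (σd t) t) ∧
    (∃ C, ∀ t ∈ Set.Icc (0 : ℝ) T, ‖σd t‖ ≤ C) ∧
    ∀ v : ι → ℝ, ∃ X : ℝ → ι → ℝ,
      Continuous X ∧ X 0 = v ∧ (∀ t ∉ exc, HasDerivAt X (rhs (σ t) (σd t) (X t)) t) ∧
      X T = B.mulVec v

lemma const_of_deriv (f : ℝ → ℝ) (hf : Continuous f) (exc : Finset ℝ)
    (hd : ∀ t ∉ exc, HasDerivAt f 0 t) (a b : ℝ) : f b = f a := by
  have := MeasureTheory.integral_eq_of_hasDerivAt_off_countable f (fun _ => 0) (a := a) (b := b)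
    (s := (exc : Set ℝ)) exc.countable_toSet hf.continuousOn
    (fun x hx => hd x (by simpa using hx.2)) (by simp)
  simp at this
  linarith

lemma sum_split (N : ι) (F : ι → ℝ) : ∑ k, F k = F N + ∑ k, (if k = N then 0 else F k) := by
  have : ∀ k, F k = (if k = N then F N else 0) + (if k = N then 0 else F k) := by
    intro k; split_ifs with h
    · simp [h]
    · simp
  rw [Finset.sum_congr rfl (fun k _ => this k), Finset.sum_add_distrib]
  simp

lemma wRHS_skew (J : ι → ℝ) (hJ : ∀ i, J i * J i = 1) (N : ι) (κ : ι → ℝ → ℝ)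
    (x xd w v : ι → ℝ) :
    ∑ k, J k * (wRHS J N κ x xd w k * v k + w k * wRHS J N κ x xd v k) = 0 := by
  rw [sum_split N]
  have h1 : J N * (wRHS J N κ x xd w N * v N + w N * wRHS J N κ x xd v N)
      = ∑ i, (if i = N then 0 else J i * κ i (x N) * xd i * (w i * v N + w N * v i)) := by
    simp only [wRHS, if_true]
    rw [Finset.sum_mul, Finset.mul_sum, ← Finset.sum_add_distrib, Finset.mul_sum]
    refine Finset.sum_congr rfl fun i _ => ?_
    split_ifs with h
    · simp
    · linear_combination (J i * κ i (x N) * xd i * (w i * v N + w N * v i)) * hJ N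
  rw [h1, ← Finset.sum_add_distrib]
  refine Finset.sum_eq_zero fun i _ => ?_
  by_cases h : i = N
  · simp [h]
  · simp only [wRHS, h, if_false]; ring

lemma holW_mem_comp (J : ι → ℝ) (hJ : ∀ i, J i * J i = 1) (N : ι) (κ : ι → ℝ → ℝ)
    (B : Matrix ι ι ℝ) (hB : HolSet (wRHS J N κ) B) :
    B ∈ connectedComponentIn {B : Matrix ι ι ℝ | Bᵀ * diagonal J * B = diagonal J} 1 := by
  obtain ⟨T, σ, σd, exc, hT, -, -, -, -, -, hX⟩ := hB
  choose W Wc W0 Wd WT using fun j : ι => hX (Pi.single j 1)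
  let Bt : ℝ → Matrix ι ι ℝ := fun t => Matrix.of fun k j => W j t k
  have hc : Continuous Bt := by
    refine continuous_pi fun k => continuous_pi fun j => ?_
    exact (continuous_apply k).comp (Wc j)
  have hB0 : Bt 0 = 1 := by
    ext k j
    simp [Bt, W0, Matrix.one_apply, Pi.single_apply]
  have hBT : Bt T = B := by
    ext k j
    simp [Bt, WT]
  have hO : ∀ t, (Bt t)ᵀ * diagonal J * Bt t = diagonal J := by
    intro t
    have hform : ∀ t a b, ((Bt t)ᵀ * diagonal J * Bt t) a b = ∑ k, J k * (W a t k * W b t k) := by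
      intro t a b
      rw [Matrix.mul_apply]
      refine Finset.sum_congr rfl fun k _ => ?_
      rw [mul_diagonal]
      simp only [transpose_apply, Bt, of_apply]
      ring
    have h0 : (Bt 0)ᵀ * diagonal J * Bt 0 = diagonal J := by rw [hB0]; simp
    refine Eq.trans ?_ h0
    ext a b
    rw [hform, hform]
    refine const_of_deriv (fun t => ∑ k, J k * (W a t k * W b t k)) ?_ exc ?_ 0 t
    · refine continuous_finset_sum _ fun k _ => ?_
      exact continuous_const.mul
        (((continuous_apply k).comp (Wc a)).mul ((continuous_apply k).comp (Wc b)))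
    · intro t ht
      rw [← wRHS_skew J hJ N κ (σ t) (σd t) (W a t) (W b t)]
      refine HasDerivAt.fun_sum fun k _ => ?_
      have ha := hasDerivAt_pi.1 (Wd a t ht) k
      have hb := hasDerivAt_pi.1 (Wd b t ht) k
      exact (ha.fun_mul hb).const_mul (J k)
  have hpre : IsPreconnected (Bt '' Set.univ) := isPreconnected_univ.image _ hc.continuousOn
  have hsub := hpre.subset_connectedComponentIn (x := (1 : Matrix ι ι ℝ))
    (F := {B : Matrix ι ι ℝ | Bᵀ * diagonal J * B = diagonal J}) ⟨0, trivial, hB0⟩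
    (by rintro _ ⟨t, -, rfl⟩; exact hO t)
  exact hsub ⟨T, trivial, hBT⟩

lemma glue_deriv (f g : ℝ → ι → ℝ) (f' g' : ι → ℝ) (T t : ℝ) (ht : t ≠ T)
    (hf : t < T → HasDerivAt f f' t) (hg : T < t → HasDerivAt g g' (t - T)) :
    HasDerivAt (fun t => if t ≤ T then f t else g (t - T)) (if t ≤ T then f' else g') t := by
  rcases lt_or_gt_of_ne ht with h | h
  · rw [if_pos h.le]
    refine (hf h).congr_of_eventuallyEq ?_
    filter_upwards [Iio_mem_nhds h] with s hs
    rw [if_pos (le_of_lt hs)]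
  · rw [if_neg (not_le.2 h)]
    refine ((hg h).comp_sub_const t T).congr_of_eventuallyEq ?_
    filter_upwards [Ioi_mem_nhds h] with s hs
    rw [if_neg (not_le.2 hs)]

lemma glue_cont (f g : ℝ → ι → ℝ) (T : ℝ) (hf : Continuous f) (hg : Continuous g)
    (h : f T = g 0) : Continuous (fun t => if t ≤ T then f t else g (t - T)) := by
  refine Continuous.if_le hf (hg.comp (continuous_id.sub continuous_const)) continuous_id
    continuous_const ?_
  intro x hx
  have hx : x = T := hx
  simp [hx, h]

lemma hol_mul (rhs : (ι → ℝ) → (ι → ℝ) → (ι → ℝ) → (ι → ℝ)) (A B : Matrix ι ι ℝ)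
    (hA : HolSet rhs A) (hB : HolSet rhs B) : HolSet rhs (A * B) := by
  obtain ⟨T₂, σ₂, τ₂, e₂, hT₂, c₂, z₂, w₂, d₂, ⟨C₂, b₂⟩, X₂⟩ := hA
  obtain ⟨T₁, σ₁, τ₁, e₁, hT₁, c₁, z₁, w₁, d₁, ⟨C₁, b₁⟩, X₁⟩ := hB
  let exc : Finset ℝ := insert T₁ (e₁ ∪ e₂.image (fun s => s + T₁))
  have hexc : ∀ t ∉ exc, t ≠ T₁ ∧ t ∉ e₁ ∧ (t - T₁) ∉ e₂ := by
    intro t ht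
    simp only [exc, Finset.mem_insert, Finset.mem_union, Finset.mem_image, not_or] at ht
    exact ⟨ht.1, ht.2.1, fun h => ht.2.2 ⟨t - T₁, h, by ring⟩⟩
  refine ⟨T₁ + T₂, fun t => if t ≤ T₁ then σ₁ t else σ₂ (t - T₁),
    fun t => if t ≤ T₁ then τ₁ t else τ₂ (t - T₁), exc, by linarith,
    glue_cont _ _ _ c₁ c₂ (by rw [w₁, z₂]), ?_, ?_, ?_, ⟨max C₁ C₂, ?_⟩, ?_⟩
  · simp [hT₁.le, z₁]
  · simp [hT₂, w₂]
  · intro t ht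
    obtain ⟨h1, h2, h3⟩ := hexc t ht
    exact glue_deriv σ₁ σ₂ _ _ T₁ t h1 (fun _ => d₁ t h2) (fun _ => d₂ _ h3)
  · intro t ht
    by_cases h : t ≤ T₁
    · simp only [h, if_true]
      exact (b₁ t ⟨ht.1, h⟩).trans (le_max_left _ _)
    · simp only [h, if_false]
      exact (b₂ _ ⟨by linarith, by linarith [ht.2]⟩).trans (le_max_right _ _)
  · intro v
    obtain ⟨Y₁, Yc₁, Y0₁, Yd₁, YT₁⟩ := X₁ v
    obtain ⟨Y₂, Yc₂, Y0₂, Yd₂, YT₂⟩ := X₂ (B.mulVec v)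
    refine ⟨fun t => if t ≤ T₁ then Y₁ t else Y₂ (t - T₁),
      glue_cont _ _ _ Yc₁ Yc₂ (by rw [YT₁, Y0₂]), ?_, ?_, ?_⟩
    · simp [hT₁.le, Y0₁]
    · intro t ht
      obtain ⟨h1, h2, h3⟩ := hexc t ht
      have := glue_deriv Y₁ Y₂ _ _ T₁ t h1 (fun _ => Yd₁ t h2) (fun _ => Yd₂ _ h3)
      convert this using 1
      by_cases h : t ≤ T₁ <;> simp [h]
    · simp [hT₂, YT₂]

lemma eM_mulVec (J : ι → ℝ) {i N : ι} (hi : i ≠ N) (w : ι → ℝ) (k : ι) :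
    (eM J i N *ᵥ w) k = if k = N then -(J i * J N * w i) else if k = i then w N else 0 := by
  rw [eM, sub_mulVec, Pi.sub_apply]
  simp only [single_mulVec, Function.update_apply, Pi.zero_apply]
  by_cases h1 : k = N
  · subst h1
    simp [hi.symm]
  · by_cases h2 : k = i <;> simp [h1, h2, hi]

lemma rM_mulVec_deriv (J : ι → ℝ) (hJ : ∀ i, J i * J i = 1) {i N : ι} (hi : i ≠ N) (w : ι → ℝ)
    (θ : ℝ → ℝ) (θ' t : ℝ) (hθ : HasDerivAt θ θ' t) :
    HasDerivAt (fun t => rM J i N (θ t) *ᵥ w) (θ' • (eM J i N *ᵥ (rM J i N (θ t) *ᵥ w))) t := by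
  rw [mulVec_mulVec, rM_eM J hi]
  refine hasDerivAt_pi.2 fun k => ?_
  have hC := (cF_deriv _ (θ t) (eps_or J hJ i N)).hasDerivAt.comp t hθ
  have hS := (sF_deriv _ (θ t) (eps_or J hJ i N)).hasDerivAt.comp t hθ
  have h := ((hC.sub_const 1).mul_const ((qM i N *ᵥ w) k)).fun_add
    (hS.mul_const ((eM J i N *ᵥ w) k))
  have h := h.const_add (w k)
  have e1 : (fun t => (rM J i N (θ t) *ᵥ w) k) = fun t => w k +
      ((((cF (J i * J N)) ∘ θ) t - 1) * (qM i N *ᵥ w) k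
        + ((sF (J i * J N)) ∘ θ) t * (eM J i N *ᵥ w) k) := by
    ext t
    simp [rM, add_mulVec, smul_mulVec, add_assoc]
  rw [e1]
  convert h using 1
  simp [add_mulVec, smul_mulVec, neg_mulVec]
  ring

lemma holW_rM (J : ι → ℝ) (hJ : ∀ i, J i * J i = 1) (N : ι) (κ : ι → ℝ → ℝ)
    {i : ι} (hi : i ≠ N) (hκ : Continuous (κ i))
    (hI : ∫ u in (0 : ℝ)..(2 * Real.pi), κ i (Real.sin u) * Real.sin u ≠ 0) (s : ℝ) :
    HolSet (wRHS J N κ) (rM J i N s) := by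
  set I := ∫ u in (0 : ℝ)..(2 * Real.pi), κ i (Real.sin u) * Real.sin u with hIdef
  set a : ℝ := - s / I with ha
  let θ : ℝ → ℝ := fun t => (-a) * ∫ u in (0 : ℝ)..t, κ i (Real.sin u) * Real.sin u
  have hcont : Continuous (fun u => κ i (Real.sin u) * Real.sin u) :=
    (hκ.comp Real.continuous_sin).mul Real.continuous_sin
  have hθ : ∀ t, HasDerivAt θ ((-a) * (κ i (Real.sin t) * Real.sin t)) t := by
    intro t
    exact ((hcont.integral_hasStrictDerivAt 0 t).hasDerivAt).const_mul (-a)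
  have hσ : ∀ t, HasDerivAt
      (fun t => (fun k => if k = N then Real.sin t else if k = i then a * (1 - Real.cos t) else 0
        : ι → ℝ))
      (fun k => if k = N then Real.cos t else if k = i then a * Real.sin t else 0) t := by
    intro t
    refine hasDerivAt_pi.2 fun k => ?_
    by_cases h1 : k = N
    · simpa [h1] using Real.hasDerivAt_sin t
    by_cases h2 : k = i
    · simp only [h1, h2, hi, if_false, if_true]
      simpa using ((Real.hasDerivAt_cos t).const_sub 1).const_mul a
    · simp only [h1, h2, if_false]
      exact hasDerivAt_const _ _
  refine ⟨2 * Real.pi, _, _, ∅, by positivity, ?_, ?_, ?_, fun t _ => hσ t, ⟨1 + |a|, ?_⟩, ?_⟩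
  · exact continuous_iff_continuousAt.2 fun t => (hσ t).continuousAt
  · ext k; simp
  · ext k; simp
  · intro t _
    refine (pi_norm_le_iff_of_nonneg (by positivity)).2 fun k => ?_
    rw [Real.norm_eq_abs]
    split_ifs
    · exact (Real.abs_cos_le_one t).trans (by linarith [abs_nonneg a])
    · rw [abs_mul]
      nlinarith [Real.abs_sin_le_one t, abs_nonneg a, abs_nonneg (Real.sin t)]
    · simp; positivity
  · intro v
    have hW := fun t => rM_mulVec_deriv J hJ hi v θ _ t (hθ t)
    refine ⟨fun t => rM J i N (θ t) *ᵥ v, ?_, ?_, ?_, ?_⟩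
    · exact continuous_iff_continuousAt.2 fun t => (hW t).continuousAt
    · simp [θ, rM_zero]
    · intro t _
      refine (hW t).congr_deriv ?_
      beta_reduce
      generalize rM J i N (θ t) *ᵥ v = w
      ext k
      rw [Pi.smul_apply, eM_mulVec J hi]
      simp only [wRHS, if_true, smul_eq_mul]
      by_cases h1 : k = N
      · simp only [h1, if_true]
        rw [Finset.sum_eq_single i]
        · simp only [hi, if_false, if_true]; ring
        · intro b _ hb
          by_cases hbN : b = N <;> simp [hb, hbN]
        · simp
      by_cases h2 : k = i
      · subst h2
        simp only [h1, if_false, if_true]; ring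
      · simp [h1, h2]
    · have : θ (2 * Real.pi) = s := by
        simp only [θ, ← hIdef, ha]
        field_simp
      simp only [this]

theorem holW_eq (J : ι → ℝ) (hJ : ∀ i, J i * J i = 1) (N : ι) (hne : ∃ i, i ≠ N) (κ : ι → ℝ → ℝ)
    (hκ : ∀ i, i ≠ N → Continuous (κ i))
    (hI : ∀ i, i ≠ N → ∫ u in (0 : ℝ)..(2 * Real.pi), κ i (Real.sin u) * Real.sin u ≠ 0)
    (B : Matrix ι ι ℝ) :
    HolSet (wRHS J N κ) B ↔
      B ∈ connectedComponentIn {B : Matrix ι ι ℝ | Bᵀ * diagonal J * B = diagonal J} 1 := by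
  refine ⟨holW_mem_comp J hJ N κ B, fun h => ?_⟩
  replace h : B ∈ mon J N := comp_subset J hJ N h
  induction h using Submonoid.closure_induction with
  | mem x hx =>
    obtain ⟨i, hi, s, rfl⟩ := hx
    exact holW_rM J hJ N κ hi (hκ i hi) (hI i hi) s
  | one =>
    obtain ⟨i, hi⟩ := hne
    have := holW_rM J hJ N κ hi (hκ i hi) (hI i hi) 0
    rwa [rM_zero] at this
  | mul x y _ _ hx hy => exact hol_mul _ _ _ hx hy

end Frame

end HolAux

namespace HolAux

section Conv

variable {ι : Type*} [Fintype ι] [DecidableEq ι]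

/-- The right-hand side of the parallel transport equation in coordinates. -/
def xRHS (N : ι) (lam mu : ι → ℝ → ℝ) (x xd X : ι → ℝ) : ι → ℝ := fun k =>
  if k = N then -(lam N (x N) * xd N * X N) + ∑ i, (if i = N then 0 else mu i (x N) * xd i * X i)
  else -(lam k (x N) * (xd k * X N + xd N * X k))

lemma conv_alg (J : ι → ℝ) (N : ι) (h lam mu κ : ι → ℝ → ℝ)
    (hκ : ∀ k, k ≠ N → ∀ s, κ k s * h N s = lam k s * h k s)
    (hmu : ∀ k, k ≠ N → ∀ s, h N s * mu k s = J k * J N * κ k s * h k s)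
    (x xd X : ι → ℝ) (k : ι) :
    wRHS J N κ x xd (fun k => h k (x N) * X k) k
      = lam k (x N) * h k (x N) * xd N * X k + h k (x N) * xRHS N lam mu x xd X k := by
  by_cases hk : k = N
  · subst hk
    simp only [wRHS, xRHS, if_true, mul_add, Finset.mul_sum]
    have : ∀ i, (if i = k then 0 else J i * J k * κ i (x k) * xd i * (h i (x k) * X i))
        = h k (x k) * (if i = k then 0 else mu i (x k) * xd i * X i) := by
      intro i
      by_cases hi : i = k
      · simp [hi]
      · simp only [hi, if_false]
        linear_combination (-(xd i * X i)) * hmu i hi (x k)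
    rw [Finset.sum_congr rfl fun i _ => this i]
    ring
  · simp only [wRHS, xRHS, hk, if_false]
    linear_combination (-(xd k * X N)) * hκ k hk (x N)

lemma conv_hol (J : ι → ℝ) (N : ι) (h lam mu κ : ι → ℝ → ℝ)
    (hpos : ∀ k s, 0 < h k s)
    (hd : ∀ k s, HasDerivAt (h k) (lam k s * h k s) s)
    (hκ : ∀ k, k ≠ N → ∀ s, κ k s * h N s = lam k s * h k s)
    (hmu : ∀ k, k ≠ N → ∀ s, h N s * mu k s = J k * J N * κ k s * h k s)
    (A : Matrix ι ι ℝ) :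
    HolSet (xRHS N lam mu) A ↔
      HolSet (wRHS J N κ) (diagonal (fun k => h k 0) * A * diagonal (fun k => (h k 0)⁻¹)) := by
  have hc : ∀ k, Continuous (h k) := fun k =>
    continuous_iff_continuousAt.2 fun s => (hd k s).continuousAt
  constructor
  · rintro ⟨T, σ, σd, exc, hT, cσ, z0, zT, dσ, bd, hX⟩
    refine ⟨T, σ, σd, exc, hT, cσ, z0, zT, dσ, bd, fun v => ?_⟩
    obtain ⟨X, cX, X0, dX, XT⟩ := hX (diagonal (fun k => (h k 0)⁻¹) *ᵥ v)
    refine ⟨fun t k => h k (σ t N) * X t k, ?_, ?_, ?_, ?_⟩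
    · refine continuous_pi fun k => ?_
      exact ((hc k).comp ((continuous_apply N).comp cσ)).mul ((continuous_apply k).comp cX)
    · ext k
      have := (hpos k 0).ne'
      simp only [z0, X0, Pi.zero_apply, mulVec_diagonal]
      field_simp
    · intro t ht
      refine hasDerivAt_pi.2 fun k => ?_
      rw [conv_alg J N h lam mu κ hκ hmu]
      have h1 := (hd k (σ t N)).comp t (hasDerivAt_pi.1 (dσ t ht) N)
      have h2 := h1.fun_mul (hasDerivAt_pi.1 (dX t ht) k)
      exact h2
    · ext k
      rw [← mulVec_mulVec, ← mulVec_mulVec, mulVec_diagonal, ← XT]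
      simp only [zT, Pi.zero_apply]
  · rintro ⟨T, σ, σd, exc, hT, cσ, z0, zT, dσ, bd, hX⟩
    refine ⟨T, σ, σd, exc, hT, cσ, z0, zT, dσ, bd, fun v => ?_⟩
    obtain ⟨W, cW, W0, dW, WT⟩ := hX (diagonal (fun k => h k 0) *ᵥ v)
    refine ⟨fun t k => W t k / h k (σ t N), ?_, ?_, ?_, ?_⟩
    · refine continuous_pi fun k => ?_
      exact ((continuous_apply k).comp cW).div
        ((hc k).comp ((continuous_apply N).comp cσ)) (fun t => (hpos k _).ne')
    · ext k
      have := (hpos k 0).ne'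
      simp only [z0, W0, Pi.zero_apply, mulVec_diagonal]
      field_simp
    · intro t ht
      refine hasDerivAt_pi.2 fun k => ?_
      have hne := (hpos k (σ t N)).ne'
      have h1 := (hd k (σ t N)).comp t (hasDerivAt_pi.1 (dσ t ht) N)
      have h2 := (hasDerivAt_pi.1 (dW t ht) k).fun_div h1 hne
      refine h2.congr_deriv ?_
      have e : W t = fun k => h k (σ t N) * (W t k / h k (σ t N)) := by
        ext k
        have := (hpos k (σ t N)).ne'
        field_simp
      have e2 := conv_alg J N h lam mu κ hκ hmu (σ t) (σd t) (fun k => W t k / h k (σ t N)) k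
      rw [← e] at e2
      rw [e2]
      simp only [Function.comp]
      field_simp
      ring
    · ext k
      have := (hpos k 0).ne'
      simp only [zT, WT, Pi.zero_apply]
      rw [← mulVec_mulVec, ← mulVec_mulVec, mulVec_diagonal]
      have e : (diagonal fun k => (h k 0)⁻¹) *ᵥ (diagonal (fun k => h k 0) *ᵥ v) = v := by
        ext k
        have := (hpos k 0).ne'
        simp only [mulVec_diagonal]
        field_simp
      rw [e]
      field_simp

end Conv

lemma integral_ne (c : ℝ) (hc : c ≠ 0) (ρ κ : ℝ → ℝ) (hρ : Continuous ρ) (hpos : ∀ s, 0 < ρ s)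
    (hκ : ∀ s, κ s = -c * (Real.sin s * ρ s)) :
    ∫ u in (0 : ℝ)..(2 * Real.pi), κ (Real.sin u) * Real.sin u ≠ 0 := by
  have e : ∀ u, κ (Real.sin u) * Real.sin u
      = -c * (Real.sin (Real.sin u) * Real.sin u * ρ (Real.sin u)) := by
    intro u; rw [hκ]; ring
  simp only [e]
  rw [intervalIntegral.integral_const_mul]
  refine mul_ne_zero (neg_ne_zero.2 hc) (ne_of_gt ?_)
  have hs : ∀ y : ℝ, -1 ≤ y → y ≤ 1 → 0 ≤ Real.sin y * y := by
    intro y h1 h2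
    rcases le_total 0 y with h | h
    · exact mul_nonneg (Real.sin_nonneg_of_nonneg_of_le_pi h (by linarith [Real.pi_gt_three])) h
    · exact mul_nonneg_of_nonpos_of_nonpos
        (Real.sin_nonpos_of_nonpos_of_neg_pi_le h (by linarith [Real.pi_gt_three])) h
  refine intervalIntegral.integral_pos (by positivity) ?_ ?_ ?_
  · exact Continuous.continuousOn (by fun_prop)
  · intro u _
    exact mul_nonneg (hs _ (Real.neg_one_le_sin u) (Real.sin_le_one u)) (hpos _).le
  · refine ⟨Real.pi / 2, ⟨by positivity, by linarith [Real.pi_pos]⟩, ?_⟩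
    rw [Real.sin_pi_div_two]
    have := Real.sin_pos_of_pos_of_lt_pi one_pos (by linarith [Real.pi_gt_three])
    have := hpos 1
    positivity

section Geo

variable {n : ℕ}

lemma partialD_one (N i : Fin n) (H : (Fin n → ℝ) → ℝ) (g : ℝ → ℝ) (g' : ℝ → ℝ)
    (hH : ∀ y, H y = g (y N)) (hg : ∀ s, HasDerivAt g (g' s) s) (x : Fin n → ℝ) :
    partialD i H x = if i = N then g' (x N) else 0 := by
  unfold partialD
  by_cases h : i = N
  · subst h
    simp only [hH, Function.update_self, if_true]
    exact (hg _).deriv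
  · simp only [hH, Function.update_of_ne (Ne.symm h), h, if_false]
    simp

lemma christ_sum (N : Fin n) (G : Fin n → (Fin n → ℝ) → ℝ) (g g' : Fin n → ℝ → ℝ)
    (hG : ∀ k y, G k y = g k (y N)) (hg : ∀ k s, HasDerivAt (g k) (g' k s) s)
    (F F' : ℝ → ℝ) (φw : (Fin n → ℝ) → ℝ) (hφ : ∀ y, φw y = F (y N))
    (hF : ∀ s, HasDerivAt F (F' s) s) (x xd X : Fin n → ℝ) :
    (fun k => -(∑ i, ∑ j, diagChristoffel G k i j x * xd i * X j)
                + (∑ i, partialD i φw x * xd i) * X k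
                + (∑ i, partialD i φw x * X i) * xd k) =
    xRHS N (fun k s => g' k s / (2 * g k s) - (if k = N then 2 else 1) * F' s)
      (fun k s => g' k s / (2 * g N s)) x xd X := by
  ext k
  have hp : ∀ i l, partialD i (G l) x = if i = N then g' l (x N) else 0 :=
    fun i l => partialD_one N i (G l) (g l) (g' l) (hG l) (hg l) x
  have hp2 : ∀ i, partialD i φw x = if i = N then F' (x N) else 0 :=
    fun i => partialD_one N i φw F F' hφ hF x
  simp only [hp2, ite_mul, zero_mul, Finset.sum_ite_eq', Finset.mem_univ, if_true]
  by_cases hk : k = N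
  · subst hk
    have e : ∀ i, ∑ j, diagChristoffel G k i j x * xd i * X j
        = (if i = k then g' k (x k) / (2 * g k (x k)) * xd k * X k else 0)
          - (if i = k then 0 else g' i (x k) / (2 * g k (x k)) * xd i * X i) := by
      intro i
      rw [Finset.sum_eq_single i]
      · by_cases hi : i = k
        · subst hi
          simp [diagChristoffel, hp, hG]
        · simp [diagChristoffel, hp, hG, hi, Ne.symm hi]
          ring
      · intro j _ hj
        by_cases hi : k = i
        · subst hi
          simp [diagChristoffel, hp, hj, hj.symm]
        · simp [diagChristoffel, hp, hj, hj.symm, hi, Ne.symm hi]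
      · simp
    rw [Finset.sum_congr rfl fun i _ => e i, Finset.sum_sub_distrib]
    simp only [Finset.sum_ite_eq', Finset.mem_univ, if_true, xRHS]
    ring
  · have e : ∀ i j, diagChristoffel G k i j x * xd i * X j
        = (if i = k then (if j = N then g' k (x N) / (2 * g k (x N)) * xd k * X N else 0) else 0)
          + (if i = N then (if j = k then g' k (x N) / (2 * g k (x N)) * xd N * X k else 0)
              else 0) := by
      intro i j
      unfold diagChristoffel
      simp only [hp, hG]
      by_cases h1 : i = k
      · subst h1
        by_cases h2 : j = N
        · subst h2
          simp [hk]
        · by_cases h3 : i = j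
          · subst h3; simp [hk]
          · simp [hk, h2, h3]
      · by_cases h2 : i = N
        · subst h2
          by_cases h3 : j = k
          · subst h3
            simp [h1, hk]
          · by_cases h4 : i = j
            · subst h4; simp [h1, hk]
            · simp [h1, h3, h4, hk, Ne.symm h3]
        · simp [h1, h2, hk, Ne.symm h1]
    simp only [e, Finset.sum_add_distrib]
    have e1 : ∀ c : ℝ, ∀ a b : Fin n, ∑ i, ∑ j, (if i = a then (if j = b then c else 0) else 0)
        = c := by
      intro c a b
      simp
    rw [e1, e1]
    simp only [xRHS, hk, if_false]
    ring

end Geo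

end HolAux

namespace HolAux

section Final

variable {n : ℕ}

/-- The frame-change factor squared. -/
noncomputable def rFun (N : Fin n) (c a : Fin n → ℝ) (f gN : ℝ → ℝ) (k : Fin n) (s : ℝ) : ℝ :=
  if k = N then gN s / f s ^ 2 else a k * (f s - c k) / (f s * |c k|)

/-- The metric coefficients. -/
noncomputable def gFun (N : Fin n) (c a : Fin n → ℝ) (f gN : ℝ → ℝ) (k : Fin n) (s : ℝ) : ℝ :=
  if k = N then gN s else a k * (f s - c k)

theorem main_abs (N : Fin n) (hne : ∃ i, i ≠ N) (J : Fin n → ℝ) (hJ : ∀ i, J i * J i = 1)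
    (c a : Fin n → ℝ) (f gN gN' : ℝ → ℝ) (hf : ∀ s, HasDerivAt f (-Real.sin s) s)
    (hfpos : ∀ s, 0 < f s) (hgNpos : ∀ s, 0 < gN s) (hgN : ∀ s, HasDerivAt gN (gN' s) s)
    (hc : ∀ k, k ≠ N → c k ≠ 0) (ha : ∀ k, k ≠ N → 0 < a k)
    (hfc : ∀ k, k ≠ N → ∀ s, 0 < f s - c k)
    (hJc : ∀ k, k ≠ N → J k * J N * c k = |c k|)
    (G : Fin n → (Fin n → ℝ) → ℝ) (hG : ∀ k y, G k y = gFun N c a f gN k (y N))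
    (F : ℝ → ℝ) (hF : ∀ s, HasDerivAt F (-Real.sin s / (2 * f s)) s)
    (φw : (Fin n → ℝ) → ℝ) (hφ : ∀ y, φw y = F (y N)) :
    ∃ P : Matrix.GeneralLinearGroup (Fin n) ℝ,
      {A : Matrix (Fin n) (Fin n) ℝ | HolSet (fun x xd X => fun k =>
        -(∑ i, ∑ j, diagChristoffel G k i j x * xd i * X j)
                + (∑ i, partialD i φw x * xd i) * X k
                + (∑ i, partialD i φw x * X i) * xd k) A}
      = (fun B => (P : Matrix (Fin n) (Fin n) ℝ) * B *
              ((P⁻¹ : Matrix.GeneralLinearGroup (Fin n) ℝ) : Matrix (Fin n) (Fin n) ℝ)) ''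
            connectedComponentIn
              {B : Matrix (Fin n) (Fin n) ℝ | Bᵀ * diagonal J * B = diagonal J} 1 := by
  let g' : Fin n → ℝ → ℝ := fun k s => if k = N then gN' s else a k * (-Real.sin s)
  have hg : ∀ k s, HasDerivAt (gFun N c a f gN k) (g' k s) s := by
    intro k s
    by_cases hk : k = N
    · have : gFun N c a f gN k = gN := by ext; simp [gFun, hk]
      rw [this]; simpa [g', hk] using hgN s
    · have : gFun N c a f gN k = fun s => a k * (f s - c k) := by ext; simp [gFun, hk]
      rw [this]; simpa [g', hk] using ((hf s).sub_const (c k)).const_mul (a k)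
  have hrhs : (fun x xd X : Fin n → ℝ => fun k =>
        -(∑ i, ∑ j, diagChristoffel G k i j x * xd i * X j)
                + (∑ i, partialD i φw x * xd i) * X k
                + (∑ i, partialD i φw x * X i) * xd k) =
      xRHS N (fun k s => g' k s / (2 * gFun N c a f gN k s)
          - (if k = N then 2 else 1) * (-Real.sin s / (2 * f s)))
        (fun k s => g' k s / (2 * gFun N c a f gN N s)) := by
    funext x xd X
    exact christ_sum N G (gFun N c a f gN) g' hG hg F _ φw hφ hF x xd X
  rw [hrhs]
  set lam : Fin n → ℝ → ℝ := fun k s => g' k s / (2 * gFun N c a f gN k s)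
          - (if k = N then 2 else 1) * (-Real.sin s / (2 * f s)) with hlam
  set mu : Fin n → ℝ → ℝ := fun k s => g' k s / (2 * gFun N c a f gN N s) with hmu
  have hlamk : ∀ k, k ≠ N → ∀ s, lam k s = -Real.sin s * c k / (2 * f s * (f s - c k)) := by
    intro k hk s
    have h1 := (hfpos s).ne'
    have h2 := (hfc k hk s).ne'
    have h3 := (ha k hk).ne'
    simp only [hlam, g', gFun, hk, if_false]
    field_simp
    ring
  let r := rFun N c a f gN
  have hrpos : ∀ k s, 0 < r k s := by
    intro k s
    have h1 := hfpos s
    by_cases hk : k = N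
    · have h2 := hgNpos s
      simp only [r, rFun, hk, if_true]; positivity
    · have h2 := hfc k hk s
      have h3 := ha k hk
      have h4 := abs_pos.2 (hc k hk)
      simp only [r, rFun, hk, if_false]; positivity
  have hrd : ∀ k s, HasDerivAt (r k) (2 * lam k s * r k s) s := by
    intro k s
    have h1 := (hfpos s).ne'
    by_cases hk : k = N
    · have h2 := (hgNpos s).ne'
      have e : r k = fun s => gN s / f s ^ 2 := by ext; simp [r, rFun, hk]
      rw [e]
      refine ((hgN s).fun_div ((hf s).fun_pow 2) (by positivity)).congr_deriv ?_
      simp only [hlam, g', gFun, hk, if_true]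
      field_simp
      push_cast
      ring
    · have h2 := (hfc k hk s).ne'
      have h3 := (ha k hk).ne'
      have h4 := (abs_pos.2 (hc k hk)).ne'
      have e : r k = fun s => a k * (f s - c k) / (f s * |c k|) := by ext; simp [r, rFun, hk]
      rw [e, hlamk k hk]
      refine ((((hf s).sub_const (c k)).const_mul (a k)).fun_div ((hf s).mul_const |c k|)
        (mul_ne_zero h1 h4)).congr_deriv ?_
      field_simp
      ring
  let h : Fin n → ℝ → ℝ := fun k s => Real.sqrt (r k s)
  have hhpos : ∀ k s, 0 < h k s := fun k s => Real.sqrt_pos.2 (hrpos k s)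
  have hhsq : ∀ k s, h k s * h k s = r k s := fun k s => Real.mul_self_sqrt (hrpos k s).le
  have hhd : ∀ k s, HasDerivAt (h k) (lam k s * h k s) s := by
    intro k s
    refine ((hrd k s).sqrt (hrpos k s).ne').congr_deriv ?_
    change 2 * lam k s * r k s / (2 * h k s) = _
    rw [← hhsq]
    have := (hhpos k s).ne'
    field_simp
  have hhc : ∀ k, Continuous (h k) := fun k =>
    continuous_iff_continuousAt.2 fun s => (hhd k s).continuousAt
  let κ : Fin n → ℝ → ℝ := fun k s => lam k s * h k s / h N s
  have hfcont : Continuous f := continuous_iff_continuousAt.2 fun s => (hf s).continuousAt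
  let ρ : Fin n → ℝ → ℝ := fun k s => h k s / (2 * f s * (f s - c k) * h N s)
  have hρc : ∀ k, k ≠ N → Continuous (ρ k) := by
    intro k hk
    refine (hhc k).div (by have := hhc N; fun_prop) fun s => ?_
    have h1 := hfpos s
    have h2 := hfc k hk s
    have h3 := hhpos N s
    positivity
  have hρpos : ∀ k, k ≠ N → ∀ s, 0 < ρ k s := by
    intro k hk s
    have h1 := hfpos s
    have h2 := hfc k hk s
    have h3 := hhpos N s
    have h4 := hhpos k s
    simp only [ρ]
    positivity
  have hκρ : ∀ k, k ≠ N → ∀ s, κ k s = -c k * (Real.sin s * ρ k s) := by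
    intro k hk s
    have h1 := (hfpos s).ne'
    have h2 := (hfc k hk s).ne'
    have h3 := (hhpos N s).ne'
    simp only [κ, ρ, hlamk k hk]
    field_simp
  have hκc : ∀ k, k ≠ N → Continuous (κ k) := by
    intro k hk
    have e : κ k = fun s => -c k * (Real.sin s * ρ k s) := funext (hκρ k hk)
    rw [e]
    have := hρc k hk
    fun_prop
  have key : ∀ A, HolSet (xRHS N lam mu) A ↔
      diagonal (fun k => h k 0) * A * diagonal (fun k => (h k 0)⁻¹) ∈ connectedComponentIn
              {B : Matrix (Fin n) (Fin n) ℝ | Bᵀ * diagonal J * B = diagonal J} 1 := by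
    intro A
    rw [conv_hol J N h lam mu κ hhpos hhd ?_ ?_ A, holW_eq J hJ N hne κ hκc ?_]
    · intro k hk
      exact integral_ne (c k) (hc k hk) (ρ k) (κ k) (hρc k hk) (hρpos k hk) (hκρ k hk)
    · intro k hk s
      have := (hhpos N s).ne'
      simp only [κ]
      field_simp
    · intro k hk s
      have h0 := (hhpos N s).ne'
      have h1 := (hfpos s).ne'
      have h2 := (hfc k hk s).ne'
      have h3 := (hgNpos s).ne'
      have h4 := (abs_pos.2 (hc k hk)).ne'
      have e : r N s * mu k s = J k * J N * lam k s * r k s := by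
        rw [hlamk k hk]
        simp only [r, rFun, hmu, g', gFun, hk, if_false, if_true]
        have := hJc k hk
        field_simp
        linear_combination (a k * Real.sin s) * this
      rw [← hhsq, ← hhsq] at e
      simp only [κ]
      field_simp
      linear_combination e
  have d1 : diagonal (fun k => (h k 0)⁻¹) * diagonal (fun k => h k 0) = 1 := by
    rw [diagonal_mul_diagonal, ← diagonal_one]
    congr 1; ext k
    exact inv_mul_cancel₀ (hhpos k 0).ne'
  have d2 : diagonal (fun k => h k 0) * diagonal (fun k => (h k 0)⁻¹) = 1 :=
    mul_eq_one_comm.1 d1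
  refine ⟨⟨diagonal (fun k => (h k 0)⁻¹), diagonal (fun k => h k 0), d1, d2⟩, ?_⟩
  ext A
  refine (key A).trans ?_
  rw [Set.mem_image]
  set D := diagonal (fun k => h k 0)
  set E := diagonal (fun k => (h k 0)⁻¹)
  constructor
  · intro hA
    refine ⟨_, hA, ?_⟩
    change E * (D * A * E) * D = A
    calc E * (D * A * E) * D = (E * D) * A * (E * D) := by simp only [mul_assoc]
      _ = A := by rw [d1]; simp
  · rintro ⟨B, hB, rfl⟩
    change D * (E * B * D) * E ∈ _
    have : D * (E * B * D) * E = B := by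
      calc D * (E * B * D) * E = (D * E) * B * (D * E) := by simp only [mul_assoc]
        _ = B := by rw [d2]; simp
    rwa [this]

end Final

end HolAux

end Helpers

theorem weighted_holonomy_of_levi_civita_metric_is_SO_plus_pq
    (p q : ℕ) (hq : 1 ≤ q) (hn : 2 ≤ p + q)
    (c : Fin (p + q) → ℝ) (φf : Fin (p + q) → ℝ → ℝ)
    (hconst : ∀ i : Fin (p + q), (i : ℕ) + 1 ≠ p + q → φf i = fun _ => c i)
    (hlast : ∀ i : Fin (p + q), (i : ℕ) + 1 = p + q →
      φf i = fun s => (p + q : ℝ) + Real.cos s)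
    (hord : ∀ i j : Fin (p + q), i < j → ∀ s t : ℝ, φf i s < φf j t)
    (hzero : ∀ (i : Fin (p + q)) (s : ℝ), φf i s ≠ 0)
    (hbound : ∀ i : Fin (p + q), (i : ℕ) + 1 ≠ p + q → c i < (p + q : ℝ) - 1)
    (hsign : ∀ i : Fin (p + q), (i : ℕ) + 1 ≠ p + q → (c i < 0 ↔ (i : ℕ) < p))
    -- the metric `g = Σ_i Π_i dx_i²` and the density `φ = ½ log|φ₁⋯φₙ|`
    (G : Fin (p + q) → (Fin (p + q) → ℝ) → ℝ) (hG : G = fun l y => lcProd φf l y)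
    (φw : (Fin (p + q) → ℝ) → ℝ)
    (hφw : φw = fun y => (1 / 2) * Real.log |∏ m, φf m (y m)|) :
    ∃ P : Matrix.GeneralLinearGroup (Fin (p + q)) ℝ,
      {A : Matrix (Fin (p + q)) (Fin (p + q)) ℝ |
        ∃ (T : ℝ) (σ σd : ℝ → Fin (p + q) → ℝ) (exc : Finset ℝ),
          0 < T ∧ Continuous σ ∧ σ 0 = 0 ∧ σ T = 0 ∧
          (∀ t ∉ exc, HasDerivAt σ (σd t) t) ∧
          (∃ C, ∀ t ∈ Set.Icc (0 : ℝ) T, ‖σd t‖ ≤ C) ∧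
          ∀ v : Fin (p + q) → ℝ, ∃ X : ℝ → Fin (p + q) → ℝ,
            Continuous X ∧ X 0 = v ∧
            (∀ t ∉ exc, HasDerivAt X (fun k =>
              -(∑ i, ∑ j, diagChristoffel G k i j (σ t) * σd t i * X t j)
                + (∑ i, partialD i φw (σ t) * σd t i) * X t k
                + (∑ i, partialD i φw (σ t) * X t i) * σd t k) t) ∧
            X T = A.mulVec v}
        = (fun B => (P : Matrix (Fin (p + q)) (Fin (p + q)) ℝ) * B *
              ((P⁻¹ : Matrix.GeneralLinearGroup (Fin (p + q)) ℝ) :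
                Matrix (Fin (p + q)) (Fin (p + q)) ℝ)) ''
            connectedComponentIn
              {B : Matrix (Fin (p + q)) (Fin (p + q)) ℝ |
                B.transpose
                    * Matrix.diagonal (fun i : Fin (p + q) => if (i : ℕ) < p then (1 : ℝ) else -1)
                    * B
                  = Matrix.diagonal (fun i : Fin (p + q) => if (i : ℕ) < p then (1 : ℝ) else -1)}
              1 := by
  subst hG hφw
  have hN : p + q - 1 < p + q := by omega
  obtain ⟨N, hNv⟩ : ∃ N : Fin (p + q), (N : ℕ) + 1 = p + q := ⟨⟨p + q - 1, hN⟩, by simp; omega⟩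
  have hneN : ∀ k : Fin (p + q), k ≠ N → (k : ℕ) + 1 ≠ p + q := by
    intro k hk h
    exact hk (Fin.ext (by omega))
  have hltN : ∀ k : Fin (p + q), k ≠ N → k < N := by
    intro k hk
    have h1 := hneN k hk
    have h2 := k.2
    exact Fin.lt_def.2 (by omega)
  have hcon : ∀ k, k ≠ N → ∀ s, φf k s = c k := by
    intro k hk s
    rw [hconst k (hneN k hk)]
  let f : ℝ → ℝ := fun s => (p + q : ℝ) + Real.cos s
  have hfN : ∀ s, φf N s = f s := by
    intro s
    rw [hlast N hNv]
  have hn' : (2 : ℝ) ≤ (p : ℝ) + q := by exact_mod_cast hn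
  have hfpos : ∀ s, 0 < f s := by
    intro s
    have := Real.neg_one_le_cos s
    simp only [f]; linarith
  have hf : ∀ s, HasDerivAt f (-Real.sin s) s := fun s => (Real.hasDerivAt_cos s).const_add _
  have hfc : ∀ k, k ≠ N → ∀ s, 0 < f s - c k := by
    intro k hk s
    have := hord k N (hltN k hk) 0 s
    rw [hcon k hk, hfN] at this
    linarith
  have hcc : ∀ k l, k ≠ N → l ≠ N → k < l → 0 < c l - c k := by
    intro k l hk hl hkl
    have := hord k l hkl 0 0
    rw [hcon k hk, hcon l hl] at this
    linarith
  have hc0 : ∀ k, k ≠ N → c k ≠ 0 := by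
    intro k hk
    have := hzero k 0
    rwa [hcon k hk] at this
  let gN : ℝ → ℝ := fun s => ∏ l ∈ Finset.univ.filter (fun l => l < N), (f s - c l)
  let a : Fin (p + q) → ℝ := fun k =>
    (∏ l ∈ Finset.univ.filter (fun l => l < k), (c k - c l)) *
    (∏ l ∈ (Finset.univ.filter (fun l => k < l)).erase N, (c l - c k))
  let F : ℝ → ℝ := fun s => (1 / 2) * Real.log (f s * ∏ m ∈ Finset.univ.erase N, c m)
  have hCne : (∏ m ∈ Finset.univ.erase N, c m) ≠ 0 :=
    Finset.prod_ne_zero_iff.2 fun m hm => hc0 m (Finset.ne_of_mem_erase hm)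
  have hgNd : Differentiable ℝ gN := by
    have hfd : Differentiable ℝ f := fun s => (hf s).differentiableAt
    intro s
    exact DifferentiableAt.fun_finset_prod fun l _ => (hfd s).sub_const _
  refine HolAux.main_abs N ?_ (fun i => if (i : ℕ) < p then (1 : ℝ) else -1) ?_ c a f gN (deriv gN)
    hf hfpos ?_ (fun s => (hgNd s).hasDerivAt) hc0 ?_ hfc ?_ _ ?_ F ?_ _ ?_
  · refine ⟨⟨0, by omega⟩, fun h => ?_⟩
    rw [← h] at hNv
    simp at hNv
    omega
  · intro i
    split_ifs <;> norm_num
  · intro s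
    refine Finset.prod_pos fun l hl => hfc l ?_ s
    exact ne_of_lt (Finset.mem_filter.1 hl).2
  · intro k hk
    refine mul_pos (Finset.prod_pos fun l hl => ?_) (Finset.prod_pos fun l hl => ?_)
    · have hlk := (Finset.mem_filter.1 hl).2
      exact hcc l k (ne_of_lt (hlk.trans (hltN k hk))) hk hlk
    · have h1 := Finset.mem_erase.1 hl
      exact hcc k l hk h1.1 (Finset.mem_filter.1 h1.2).2
  · intro k hk
    have h1 : ¬ (N : ℕ) < p := by omega
    have h2 := hsign k (hneN k hk)
    simp only [h1, if_false]
    by_cases h3 : (k : ℕ) < p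
    · simp only [h3, if_true]
      rw [abs_of_neg (h2.2 h3)]; ring
    · simp only [h3, if_false]
      rw [abs_of_nonneg (not_lt.1 fun h => h3 (h2.1 h))]; ring
  · intro k y
    by_cases hk : k = N
    · subst hk
      simp only [lcProd, HolAux.gFun, if_true, gN]
      have h1 : Finset.univ.filter (fun l : Fin (p + q) => k < l) = ∅ := by
        refine Finset.filter_eq_empty_iff.2 fun l _ hl => ?_
        have := l.2
        have := Fin.lt_def.1 hl
        omega
      rw [h1, Finset.prod_empty, mul_one]
      refine Finset.prod_congr rfl fun l hl => ?_
      rw [hfN, hcon l (ne_of_lt (Finset.mem_filter.1 hl).2)]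
    · simp only [lcProd, HolAux.gFun, hk, if_false, a]
      have h1 : N ∈ Finset.univ.filter (fun l : Fin (p + q) => k < l) := by
        simp [hltN k hk]
      rw [← Finset.mul_prod_erase _ _ h1]
      have e1 : ∏ l ∈ Finset.univ.filter (fun l => l < k), (φf k (y k) - φf l (y l))
          = ∏ l ∈ Finset.univ.filter (fun l => l < k), (c k - c l) := by
        refine Finset.prod_congr rfl fun l hl => ?_
        have hlk := (Finset.mem_filter.1 hl).2
        rw [hcon k hk, hcon l (ne_of_lt (hlk.trans (hltN k hk)))]
      have e2 : ∏ l ∈ (Finset.univ.filter (fun l => k < l)).erase N, (φf l (y l) - φf k (y k))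
          = ∏ l ∈ (Finset.univ.filter (fun l => k < l)).erase N, (c l - c k) := by
        refine Finset.prod_congr rfl fun l hl => ?_
        rw [hcon k hk, hcon l (Finset.ne_of_mem_erase hl)]
      rw [e1, e2, hfN, hcon k hk]
      ring
  · intro s
    have h1 := (hfpos s).ne'
    refine ((((hf s).mul_const _).log (mul_ne_zero h1 hCne)).const_mul (1 / 2)).congr_deriv ?_
    field_simp
  · intro y
    simp only [F, Real.log_abs]
    rw [← Finset.mul_prod_erase _ _ (Finset.mem_univ N), hfN]
    congr 3
    exact Finset.prod_congr rfl fun m hm => hcon m (Finset.ne_of_mem_erase hm) _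
end
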